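/- arXiv:2005.01635 — 2 statements merged into one kernel-verified Lean document; each statement's English description precedes it below -/
import Mathlib

section
/- Let Γ be a finite connected simple cubic vertex-transitive graph of girth 6 with signature (a, b, c) where c = 6. Then a = b = 6 and Γ is isomorphic to the Möbius–Kantor graph GP(8, 3), equivalently to Ψ_8 = Cay(D_8, {τ_0, τ_1, τ_3}). -/
/-- The Cayley graph of a group on a (symmetric) connection set `S`:
distinct `g, h` are adjacent iff `g * h⁻¹ ∈ S`. -/
def cayley {G : Type*} [Group G] (S : Set G) : SimpleGraph G :=
  SimpleGraph.fromRel (fun x y => x * y⁻¹ ∈ S)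

/-- In the dihedral group `D_n = ⟨ρ, τ⟩`, the element `τ_i = ρ^i * τ`. -/
def dihTau {n : ℕ} (i : ℕ) : DihedralGroup n :=
  (DihedralGroup.r 1) ^ i * DihedralGroup.sr 0

/-- The number of cycles of length 6 in `G` (identified with their edge sets)
that contain the edge `e`. -/
noncomputable def sixCycleCount {V : Type*} (G : SimpleGraph V) (e : Sym2 V) : ℕ :=
  Set.ncard {s : Set (Sym2 V) |
    (∃ (v : V) (w : G.Walk v v), w.IsCycle ∧ w.length = 6 ∧ s = {e' | e' ∈ w.edges}) ∧ e ∈ s}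

/-- A cubic graph of girth 6 is girth-regular with signature `(a, b, c)` if every vertex is
incident with exactly three edges, on which the numbers of girth cycles (6-cycles) are
`a`, `b`, `c` respectively. -/
def hasSignature {V : Type*} (G : SimpleGraph V) (a b c : ℕ) : Prop :=
  ∀ v : V, ∃ e₁ e₂ e₃ : Sym2 V, e₁ ≠ e₂ ∧ e₁ ≠ e₃ ∧ e₂ ≠ e₃ ∧
    G.incidenceSet v = {e₁, e₂, e₃} ∧
    sixCycleCount G e₁ = a ∧ sixCycleCount G e₂ = b ∧ sixCycleCount G e₃ = c

/-- The graph `Ψ_n = Cay(D_n, {τ_0, τ_1, τ_3})`. -/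
def psiGraph (n : ℕ) : SimpleGraph (DihedralGroup n) :=
  cayley ({dihTau 0, dihTau 1, dihTau 3} : Set (DihedralGroup n))

/-- The generalized Petersen graph `GP(n, k)`: the outer vertices `a_i` are encoded
as `(i, false)`, the inner vertices `b_i` as `(i, true)`, with edges
`{a_i, a_{i+1}}`, `{a_i, b_i}`, and `{b_i, b_{i+k}}`. -/
def genPetersen (n k : ℕ) : SimpleGraph (ZMod n × Bool) :=
  SimpleGraph.fromRel (fun p q =>
    (p.2 = false ∧ q.2 = false ∧ q.1 = p.1 + 1) ∨
    (p.2 = false ∧ q.2 = true ∧ q.1 = p.1) ∨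
    (p.2 = true ∧ q.2 = true ∧ q.1 = p.1 + (k : ZMod n)))

/-- The vertex `v` has exactly the three distinct neighbours `a`, `b`, `c`. -/
structure HasNeighbors {V : Type*} (Γ : SimpleGraph V) (v a b c : V) : Prop where
  ne₁₂ : a ≠ b
  ne₁₃ : a ≠ c
  ne₂₃ : b ≠ c
  adj_iff : ∀ x, Γ.Adj v x ↔ x = a ∨ x = b ∨ x = c

/-- A graph without cycles of length 3, 4 and 5. -/
structure GirthGeSix {V : Type*} (Γ : SimpleGraph V) : Prop where
  no_three : ∀ a b c, Γ.Adj a b → Γ.Adj b c → Γ.Adj c a → False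
  no_four : ∀ a b c d, Γ.Adj a b → Γ.Adj b c → Γ.Adj c d → Γ.Adj d a → a = c ∨ b = d
  no_five : ∀ a b c d e, Γ.Adj a b → Γ.Adj b c → Γ.Adj c d → Γ.Adj d e → Γ.Adj e a → False

/-- The edge set of the closed walk `v₀ v₁ v₂ v₃ v₄ v₅ v₀`. -/
def hexagonEdges {V : Type*} (v₀ v₁ v₂ v₃ v₄ v₅ : V) : Set (Sym2 V) :=
  {s(v₀, v₁), s(v₁, v₂), s(v₂, v₃), s(v₃, v₄), s(v₄, v₅), s(v₅, v₀)}

/-- The vertices `v₀ v₁ v₂ v₃ v₄ v₅` form, in this cyclic order, a 6-cycle of the graph. -/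
structure IsHexagon {V : Type*} (Γ : SimpleGraph V) (v₀ v₁ v₂ v₃ v₄ v₅ : V) : Prop where
  nodup : [v₀, v₁, v₂, v₃, v₄, v₅].Nodup
  adj₀ : Γ.Adj v₀ v₁
  adj₁ : Γ.Adj v₁ v₂
  adj₂ : Γ.Adj v₂ v₃
  adj₃ : Γ.Adj v₃ v₄
  adj₄ : Γ.Adj v₄ v₅
  adj₅ : Γ.Adj v₅ v₀

/-- The vertices `x` and `y` have a common neighbour. -/
def Linked {V : Type*} (Γ : SimpleGraph V) (x y : V) : Prop :=
  ∃ w, Γ.Adj x w ∧ Γ.Adj w y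

/-- For a path `a m b` in a graph of girth 6, the number of 6-cycles containing this path. -/
noncomputable def hexCount {V : Type*} (Γ : SimpleGraph V) (a m b : V) : ℕ :=
  Set.ncard {p : V × V | (Γ.Adj a p.1 ∧ p.1 ≠ m) ∧ (Γ.Adj b p.2 ∧ p.2 ≠ m) ∧ Linked Γ p.1 p.2}

namespace HasNeighbors

variable {V : Type*} {Γ : SimpleGraph V} {v a b c : V}

lemma rotate (h : HasNeighbors Γ v a b c) : HasNeighbors Γ v b c a :=
  ⟨h.ne₂₃, h.ne₁₂.symm, h.ne₁₃.symm, fun x => by rw [h.adj_iff]; tauto⟩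

lemma swap (h : HasNeighbors Γ v a b c) : HasNeighbors Γ v a c b :=
  ⟨h.ne₁₃, h.ne₁₂, h.ne₂₃.symm, fun x => by rw [h.adj_iff]; tauto⟩

lemma adj₁ (h : HasNeighbors Γ v a b c) : Γ.Adj v a := (h.adj_iff a).2 (by simp)

lemma adj₂ (h : HasNeighbors Γ v a b c) : Γ.Adj v b := (h.adj_iff b).2 (by simp)

lemma adj₃ (h : HasNeighbors Γ v a b c) : Γ.Adj v c := (h.adj_iff c).2 (by simp)

end HasNeighbors

section Cubic

variable {V : Type*} {Γ : SimpleGraph V}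

lemma exists_hasNeighbors (hcubic : ∀ v : V, (Γ.neighborSet v).ncard = 3) (v : V) :
    ∃ a b c, HasNeighbors Γ v a b c := by
  obtain ⟨a, b, c, hab, hac, hbc, h⟩ := Set.ncard_eq_three.1 (hcubic v)
  refine ⟨a, b, c, hab, hac, hbc, fun x => ?_⟩
  rw [← SimpleGraph.mem_neighborSet, h]
  simp

lemma exists_hasNeighbors_of_adj (hcubic : ∀ v : V, (Γ.neighborSet v).ncard = 3) {v a : V}
    (h : Γ.Adj v a) : ∃ b c, HasNeighbors Γ v a b c := by
  obtain ⟨x, y, z, hv⟩ := exists_hasNeighbors hcubic v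
  rcases (hv.adj_iff a).1 h with rfl | rfl | rfl
  · exact ⟨_, _, hv⟩
  · exact ⟨_, _, hv.rotate⟩
  · exact ⟨_, _, hv.rotate.rotate⟩

lemma exists_hasNeighbors_of_adj₂ (hcubic : ∀ v : V, (Γ.neighborSet v).ncard = 3) {v a b : V}
    (ha : Γ.Adj v a) (hb : Γ.Adj v b) (hab : a ≠ b) : ∃ c, HasNeighbors Γ v a b c := by
  obtain ⟨x, y, hv⟩ := exists_hasNeighbors_of_adj hcubic ha
  rcases (hv.adj_iff b).1 hb with rfl | rfl | rfl
  · exact absurd rfl hab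
  · exact ⟨_, hv⟩
  · exact ⟨_, hv.swap⟩

lemma girthGeSix_of_girth_eq (hgirth : Γ.girth = 6) : GirthGeSix Γ := by
  have key : ∀ {v : V} (w : Γ.Walk v v), w.IsCycle → 6 ≤ w.length := fun w hw =>
    hgirth ▸ SimpleGraph.girth_le_length hw
  have h3 : ∀ a b c, Γ.Adj a b → Γ.Adj b c → Γ.Adj c a → False := by
    intro a b c hab hbc hca
    have hc : (SimpleGraph.Walk.cons hab (.cons hbc (.cons hca .nil))).IsCycle := by
      simp [SimpleGraph.Walk.isCycle_def, SimpleGraph.Walk.isTrail_def,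
        hab.ne, hab.ne', hbc.ne, hca.ne,
        hca.ne']
    simpa using key _ hc
  have h4 : ∀ a b c d, Γ.Adj a b → Γ.Adj b c → Γ.Adj c d → Γ.Adj d a → a = c ∨ b = d := by
    intro a b c d hab hbc hcd hda
    by_contra! hne
    have hc : (SimpleGraph.Walk.cons hab (.cons hbc (.cons hcd (.cons hda .nil)))).IsCycle := by
      simp [SimpleGraph.Walk.isCycle_def, SimpleGraph.Walk.isTrail_def,
        hab.ne, hab.ne', hbc.ne, hcd.ne,
        hda.ne, hda.ne', hne.1, hne.1.symm, hne.2]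
    simpa using key _ hc
  refine ⟨h3, h4, fun a b c d e hab hbc hcd hde hea => ?_⟩
  have hac : a ≠ c := by rintro rfl; exact h3 _ _ _ hcd hde hea
  have had : a ≠ d := by rintro rfl; exact h3 _ _ _ hab hbc hcd
  have hbd : b ≠ d := by rintro rfl; exact h3 _ _ _ hde hea hab
  have hbe : b ≠ e := by rintro rfl; exact h3 _ _ _ hbc hcd hde
  have hce : c ≠ e := by rintro rfl; exact h3 _ _ _ hea hab hbc
  have hc : (SimpleGraph.Walk.cons hab
      (.cons hbc (.cons hcd (.cons hde (.cons hea .nil))))).IsCycle := by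
    simp [SimpleGraph.Walk.isCycle_def, SimpleGraph.Walk.isTrail_def,
        hab.ne, hab.ne', hbc.ne, hcd.ne,
      hde.ne, hea.ne, hea.ne', hac, hac.symm, had, had.symm, hbd, hbe, hce]
  simpa using key _ hc

lemma IsHexagon.rotate {a b c d e f : V} (h : IsHexagon Γ a b c d e f) :
    IsHexagon Γ b c d e f a :=
  ⟨by have := h.nodup; simp at this ⊢; grind, h.adj₁, h.adj₂, h.adj₃, h.adj₄, h.adj₅, h.adj₀⟩

lemma IsHexagon.reverse {a b c d e f : V} (h : IsHexagon Γ a b c d e f) :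
    IsHexagon Γ b a f e d c :=
  ⟨by have := h.nodup; simp at this ⊢; grind, h.adj₀.symm, h.adj₅.symm, h.adj₄.symm, h.adj₃.symm,
    h.adj₂.symm, h.adj₁.symm⟩

lemma hexagonEdges_rotate (a b c d e f : V) :
    hexagonEdges b c d e f a = hexagonEdges a b c d e f := by
  ext x; simp only [hexagonEdges, Set.mem_insert_iff, Set.mem_singleton_iff]; tauto

lemma hexagonEdges_reverse (a b c d e f : V) :
    hexagonEdges b a f e d c = hexagonEdges a b c d e f := by
  ext x
  simp only [hexagonEdges, Set.mem_insert_iff, Set.mem_singleton_iff,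
    Sym2.eq_swap (a := b) (b := a),
    Sym2.eq_swap (a := f) (b := e), Sym2.eq_swap (a := e) (b := d), Sym2.eq_swap (a := d) (b := c),
    Sym2.eq_swap (a := c) (b := b), Sym2.eq_swap (a := a) (b := f)]
  tauto

lemma exists_isCycle_iff (s : Set (Sym2 V)) :
    (∃ (v : V) (w : Γ.Walk v v), w.IsCycle ∧ w.length = 6 ∧ s = {e | e ∈ w.edges}) ↔
      ∃ a b c d e f, IsHexagon Γ a b c d e f ∧ s = hexagonEdges a b c d e f := by
  constructor
  · rintro ⟨v, w, hc, hl, rfl⟩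
    rcases w with _ | ⟨h0, _ | ⟨h1, _ | ⟨h2, _ | ⟨h3, _ | ⟨h4, _ | ⟨h5, _ | ⟨h6, w⟩⟩⟩⟩⟩⟩⟩ <;>
      simp at hl
    have hn := hc.support_nodup
    refine ⟨_, _, _, _, _, _, ⟨?_, h0, h1, h2, h3, h4, h5⟩, ?_⟩
    · simp at hn ⊢; grind
    · ext x; simp [hexagonEdges]
  · rintro ⟨a, b, c, d, e, f, h, rfl⟩
    refine ⟨a, .cons h.adj₀ (.cons h.adj₁ (.cons h.adj₂ (.cons h.adj₃ (.cons h.adj₄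
      (.cons h.adj₅ .nil))))), ?_, rfl, ?_⟩
    · have := h.nodup
      simp [SimpleGraph.Walk.isCycle_def, SimpleGraph.Walk.isTrail_def] at this ⊢
      grind
    · ext x; simp [hexagonEdges]

lemma exists_isHexagon_of_mem {a b c d e f x y : V} (h : IsHexagon Γ a b c d e f)
    (hxy : s(x, y) ∈ hexagonEdges a b c d e f) :
    ∃ p q r t, IsHexagon Γ x y p q r t ∧ hexagonEdges a b c d e f = hexagonEdges x y p q r t := by
  have start : ∀ {a b c d e f : V}, IsHexagon Γ a b c d e f → s(x, y) = s(a, b) →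
      ∃ p q r t, IsHexagon Γ x y p q r t ∧
        hexagonEdges a b c d e f = hexagonEdges x y p q r t := by
    intro a b c d e f h hxy
    rcases Sym2.eq_iff.1 hxy with ⟨rfl, rfl⟩ | ⟨rfl, rfl⟩
    · exact ⟨_, _, _, _, h, rfl⟩
    · exact ⟨_, _, _, _, h.reverse, (hexagonEdges_reverse ..).symm⟩
  rcases hxy with hxy | hxy | hxy | hxy | hxy | hxy
  · exact start h hxy
  · rw [← hexagonEdges_rotate]; exact start h.rotate hxy
  · rw [← hexagonEdges_rotate, ← hexagonEdges_rotate]; exact start h.rotate.rotate hxy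
  · rw [← hexagonEdges_rotate, ← hexagonEdges_rotate, ← hexagonEdges_rotate]
    exact start h.rotate.rotate.rotate hxy
  · rw [← hexagonEdges_rotate, ← hexagonEdges_rotate, ← hexagonEdges_rotate,
      ← hexagonEdges_rotate]
    exact start h.rotate.rotate.rotate.rotate hxy
  · rw [← hexagonEdges_rotate, ← hexagonEdges_rotate, ← hexagonEdges_rotate,
      ← hexagonEdges_rotate, ← hexagonEdges_rotate]
    exact start h.rotate.rotate.rotate.rotate.rotate hxy

lemma hexagonEdges_injective {m b p q r t p' q' r' t' : V} (h : IsHexagon Γ m b p q r t)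
    (h' : IsHexagon Γ m b p' q' r' t')
    (heq : hexagonEdges m b p q r t = hexagonEdges m b p' q' r' t') :
    p = p' ∧ q = q' ∧ r = r' ∧ t = t' := by
  have hn := h.nodup
  have hn' := h'.nodup
  have mem : ∀ e, e ∈ hexagonEdges m b p q r t → e ∈ hexagonEdges m b p' q' r' t' :=
    fun e he => heq ▸ he
  simp only [List.nodup_cons, List.mem_cons, not_or] at hn hn'
  have e1 : p = p' := by
    have := mem s(b, p) (by simp [hexagonEdges])
    simp [hexagonEdges] at this; grind
  have e2 : q = q' := by
    have := mem s(p, q) (by simp [hexagonEdges])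
    simp [hexagonEdges] at this; grind
  have e3 : r = r' := by
    have := mem s(q, r) (by simp [hexagonEdges])
    simp [hexagonEdges] at this; grind
  have e4 : t = t' := by
    have := mem s(r, t) (by simp [hexagonEdges])
    simp [hexagonEdges] at this; grind
  exact ⟨e1, e2, e3, e4⟩

lemma isHexagon_of_path (hg : GirthGeSix Γ) {m b p q r t : V} (h0 : Γ.Adj m b) (h1 : Γ.Adj b p)
    (h2 : Γ.Adj p q) (h3 : Γ.Adj q r) (h4 : Γ.Adj r t) (h5 : Γ.Adj t m) (hbt : b ≠ t)
    (hpm : p ≠ m) (hrm : r ≠ m) : IsHexagon Γ m b p q r t := by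
  refine ⟨?_, h0, h1, h2, h3, h4, h5⟩
  have := hg.no_three
  have := hg.no_four
  have := hg.no_five
  have a1 : m ≠ q := by rintro rfl; exact hg.no_three _ _ _ h0 h1 h2
  have a2 : b ≠ q := by
    rintro rfl; rcases hg.no_four _ _ _ _ h0 h3 h4 h5 with h | h <;> grind
  have a3 : b ≠ r := by rintro rfl; exact hg.no_three _ _ _ h0 h4 h5
  have a4 : p ≠ r := by
    rintro rfl; rcases hg.no_four _ _ _ _ h0 h1 h4 h5 with h | h <;> grind
  have a5 : p ≠ t := by rintro rfl; exact hg.no_three _ _ _ h0 h1 h5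
  have a6 : q ≠ t := by
    rintro rfl; rcases hg.no_four _ _ _ _ h0 h1 h2 h5 with h | h <;> grind
  have := h0.ne
  have := h1.ne
  have := h2.ne
  have := h3.ne
  have := h4.ne
  have := h5.ne
  simp only [List.nodup_cons, List.mem_cons, not_or]
  grind

/-- The 6-cycles through the path `a m b` are counted by `hexCount`. -/
lemma hexCount_eq_ncard (hg : GirthGeSix Γ) {a m b : V} (ha : Γ.Adj m a)
    (hb : Γ.Adj m b) (hab : a ≠ b) :
    hexCount Γ a m b =
      {s | ∃ p q r, IsHexagon Γ m b p q r a ∧ s = hexagonEdges m b p q r a}.ncard := by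
  have hex : ∀ {x y q : V}, (Γ.Adj a x ∧ x ≠ m) → (Γ.Adj b y ∧ y ≠ m) → Γ.Adj x q → Γ.Adj q y →
      IsHexagon Γ m b y q x a := fun hx hy h1 h2 =>
    isHexagon_of_path hg hb hy.1 h2.symm h1.symm hx.1.symm ha.symm hab.symm hy.2 hx.2
  refine Set.ncard_congr (fun p hp => hexagonEdges m b p.2 hp.2.2.choose p.1 a) ?_ ?_ ?_
  · rintro ⟨x, y⟩ hp
    obtain ⟨h1, h2⟩ := hp.2.2.choose_spec
    exact ⟨_, _, _, hex hp.1 hp.2.1 h1 h2, rfl⟩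
  · rintro ⟨x, y⟩ ⟨x', y'⟩ hp hp' heq
    obtain ⟨h1, h2⟩ := hp.2.2.choose_spec
    obtain ⟨h1', h2'⟩ := hp'.2.2.choose_spec
    have := hexagonEdges_injective (hex hp.1 hp.2.1 h1 h2) (hex hp'.1 hp'.2.1 h1' h2') heq
    exact Prod.ext this.2.2.1 this.1
  · rintro s ⟨y, q, x, h, rfl⟩
    have hn := h.nodup
    simp only [List.nodup_cons, List.mem_cons, not_or] at hn
    have hp : (Γ.Adj a x ∧ x ≠ m) ∧ (Γ.Adj b y ∧ y ≠ m) ∧ Linked Γ x y :=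
      ⟨⟨h.adj₄.symm, by grind⟩, ⟨h.adj₁, by grind⟩, q, h.adj₃.symm, h.adj₂.symm⟩
    refine ⟨(x, y), hp, ?_⟩
    obtain ⟨h1, h2⟩ := hp.2.2.choose_spec
    have hq : hp.2.2.choose = q := by
      rcases hg.no_four _ _ _ _ h1 h2 h.adj₂ h.adj₃ with h' | h'
      · grind
      · exact h'
    simp only [hq]

lemma sixCycleCount_eq_add [Finite V] (hg : GirthGeSix Γ) {m a b c : V}
    (hm : HasNeighbors Γ m a b c) :
    sixCycleCount Γ s(m, b) = hexCount Γ a m b + hexCount Γ c m b := by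
  rw [hexCount_eq_ncard hg hm.adj₁ hm.adj₂ hm.ne₁₂,
    hexCount_eq_ncard hg hm.adj₃ hm.adj₂ hm.ne₂₃.symm, ← Set.ncard_union_eq _ (Set.toFinite _)
    (Set.toFinite _), sixCycleCount]
  · congr 1
    ext s
    simp only [exists_isCycle_iff, Set.mem_ofPred_eq, Set.mem_union]
    constructor
    · rintro ⟨⟨x1, x2, x3, x4, x5, x6, h, rfl⟩, hmem⟩
      obtain ⟨p, q, r, t, h', he⟩ := exists_isHexagon_of_mem h hmem
      rw [he]
      have hn := h'.nodup
      simp only [List.nodup_cons, List.mem_cons, not_or] at hn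
      rcases (hm.adj_iff t).1 h'.adj₅.symm with rfl | rfl | rfl
      · exact .inl ⟨p, q, r, h', rfl⟩
      · grind
      · exact .inr ⟨p, q, r, h', rfl⟩
    · rintro (⟨p, q, r, h, rfl⟩ | ⟨p, q, r, h, rfl⟩)
      · exact ⟨⟨_, _, _, _, _, _, h, rfl⟩, by simp [hexagonEdges]⟩
      · exact ⟨⟨_, _, _, _, _, _, h, rfl⟩, by simp [hexagonEdges]⟩
  · rw [Set.disjoint_left]
    rintro s ⟨p, q, r, h, rfl⟩ ⟨p', q', r', h', heq⟩
    exact hm.ne₁₃ (hexagonEdges_injective h h' heq).2.2.2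

end Cubic

section Counting

variable {V : Type*} {Γ : SimpleGraph V}

lemma Linked.symm {x y : V} (h : Linked Γ x y) : Linked Γ y x :=
  let ⟨w, h1, h2⟩ := h
  ⟨w, h2.symm, h1.symm⟩

lemma HasNeighbors.linked_iff {x y a b c : V} (h : HasNeighbors Γ x a b c) :
    Linked Γ x y ↔ Γ.Adj a y ∨ Γ.Adj b y ∨ Γ.Adj c y := by
  constructor
  · rintro ⟨w, h1, h2⟩
    rcases (h.adj_iff w).1 h1 with rfl | rfl | rfl <;> tauto
  · rintro (h' | h' | h')
    · exact ⟨_, h.adj₁, h'⟩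
    · exact ⟨_, h.adj₂, h'⟩
    · exact ⟨_, h.adj₃, h'⟩

lemma hexCount_comm (a m b : V) : hexCount Γ a m b = hexCount Γ b m a := by
  refine Set.ncard_congr (fun p _ => p.swap) ?_ ?_ ?_
  · exact fun p hp => ⟨hp.2.1, hp.1, hp.2.2.symm⟩
  · exact fun p q _ _ h => Prod.swap_injective h
  · exact fun p hp => ⟨p.swap, ⟨hp.2.1, hp.1, hp.2.2.symm⟩, rfl⟩

open Classical in
lemma hexCount_eq_sum {a m b x x' y y' : V} (ha : HasNeighbors Γ a m x x')
    (hb : HasNeighbors Γ b m y y') :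
    hexCount Γ a m b = (if Linked Γ x y then 1 else 0) + (if Linked Γ x y' then 1 else 0) +
      ((if Linked Γ x' y then 1 else 0) + (if Linked Γ x' y' then 1 else 0)) := by
  have h : {p : V × V | (Γ.Adj a p.1 ∧ p.1 ≠ m) ∧ (Γ.Adj b p.2 ∧ p.2 ≠ m) ∧ Linked Γ p.1 p.2} =
      ((({x, x'} : Finset V) ×ˢ ({y, y'} : Finset V)).filter fun p => Linked Γ p.1 p.2 :
        Finset (V × V)) := by
    ext ⟨p, q⟩
    have := ha.ne₁₂
    have := ha.ne₁₃
    have := hb.ne₁₂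
    have := hb.ne₁₃
    simp only [ha.adj_iff, hb.adj_iff, Set.mem_ofPred_eq, Finset.coe_filter, Finset.mem_product,
      Finset.mem_insert, Finset.mem_singleton]
    grind
  rw [hexCount, h, Set.ncard_coe_finset, Finset.card_filter, Finset.sum_product,
    Finset.sum_pair ha.ne₂₃, Finset.sum_pair hb.ne₂₃, Finset.sum_pair hb.ne₂₃]

lemma hexCount_le_four {a m b x x' y y' : V} (ha : HasNeighbors Γ a m x x')
    (hb : HasNeighbors Γ b m y y') : hexCount Γ a m b ≤ 4 := by
  rw [hexCount_eq_sum ha hb]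
  split_ifs <;> simp

open Classical in
/-- For an edge `u v` with further neighbours `u₀` of `u` and `v₀` of `v`, the edges joining the
remaining neighbours of `u₀` to those of `v₀` can be counted from either end. -/
lemma linked_sum_comm (hg : GirthGeSix Γ) {u v u₀ v₀ p p' q q' : V} (huv : Γ.Adj u v)
    (hu₀ : HasNeighbors Γ u₀ u p p') (hv₀ : HasNeighbors Γ v₀ v q q') (hu : u₀ ≠ v) (hv : v₀ ≠ u) :
    (if Linked Γ p v₀ then 1 else 0) + (if Linked Γ p' v₀ then 1 else 0) =
      (if Linked Γ q u₀ then 1 else 0) + (if Linked Γ q' u₀ then 1 else 0) := by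
  have h1 : ∀ r, Linked Γ r v₀ ↔ Γ.Adj r v ∨ Γ.Adj r q ∨ Γ.Adj r q' := fun r => by
    rw [show Linked Γ r v₀ ↔ Linked Γ v₀ r from ⟨.symm, .symm⟩, hv₀.linked_iff]
    simp only [Γ.adj_comm]
  have h2 : ∀ r, Linked Γ r u₀ ↔ Γ.Adj r u ∨ Γ.Adj r p ∨ Γ.Adj r p' := fun r => by
    rw [show Linked Γ r u₀ ↔ Linked Γ u₀ r from ⟨.symm, .symm⟩, hu₀.linked_iff]
    simp only [Γ.adj_comm]
  have far : ∀ {u v u₀ p : V}, Γ.Adj u v → Γ.Adj u₀ u → Γ.Adj u₀ p → u₀ ≠ v → p ≠ u →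
      ¬ Γ.Adj p v := fun {u v u₀ p} huv h h' hne hne' hpv => by
    rcases hg.no_four _ _ _ _ h' hpv huv.symm h.symm with h | h
    · exact hne h
    · exact hne' h
  have e1 := far huv hu₀.adj₁ hu₀.adj₂ hu hu₀.ne₁₂.symm
  have e2 := far huv hu₀.adj₁ hu₀.adj₃ hu hu₀.ne₁₃.symm
  have e3 := far huv.symm hv₀.adj₁ hv₀.adj₂ hv hv₀.ne₁₂.symm
  have e4 := far huv.symm hv₀.adj₁ hv₀.adj₃ hv hv₀.ne₁₃.symm
  have n1 : ∀ r, Γ.Adj r p → Γ.Adj r p' → r = u₀ := fun r hr hr' => by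
    by_contra hne
    exact (hg.no_four _ _ _ _ hr hu₀.adj₂.symm hu₀.adj₃ hr'.symm).elim hne hu₀.ne₂₃
  have n2 : ∀ r, Γ.Adj r q → Γ.Adj r q' → r = v₀ := fun r hr hr' => by
    by_contra hne
    exact (hg.no_four _ _ _ _ hr hv₀.adj₂.symm hv₀.adj₃ hr'.symm).elim hne hv₀.ne₂₃
  have hn : ¬ Γ.Adj u₀ v₀ := fun h =>
    (hg.no_four _ _ _ _ h hv₀.adj₁ huv.symm hu₀.adj₁.symm).elim hu hv
  have f1 : p ≠ v₀ := by rintro rfl; exact hn hu₀.adj₂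
  have f2 : p' ≠ v₀ := by rintro rfl; exact hn hu₀.adj₃
  have f3 : q ≠ u₀ := by rintro rfl; exact hn hv₀.adj₂.symm
  have f4 : q' ≠ u₀ := by rintro rfl; exact hn hv₀.adj₃.symm
  have g1 : ¬ (Γ.Adj p q ∧ Γ.Adj p q') := fun h => f1 (n2 _ h.1 h.2)
  have g2 : ¬ (Γ.Adj p' q ∧ Γ.Adj p' q') := fun h => f2 (n2 _ h.1 h.2)
  have g3 : ¬ (Γ.Adj p q ∧ Γ.Adj p' q) := fun h => f3 (n1 _ h.1.symm h.2.symm)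
  have g4 : ¬ (Γ.Adj p q' ∧ Γ.Adj p' q') := fun h => f4 (n1 _ h.1.symm h.2.symm)
  simp only [h1, h2, e1, e2, e3, e4, false_or, Γ.adj_comm q, Γ.adj_comm q']
  grind

/-- The three vertices adjacent to `v`, ordered according to the signature. -/
lemma exists_hasNeighbors_of_hasSignature {a b c : ℕ} (hsig : hasSignature Γ a b c) (v : V) :
    ∃ x y z, HasNeighbors Γ v x y z ∧ sixCycleCount Γ s(v, x) = a ∧
      sixCycleCount Γ s(v, y) = b ∧ sixCycleCount Γ s(v, z) = c := by
  obtain ⟨e₁, e₂, e₃, h12, h13, h23, hinc, ha, hb, hc⟩ := hsig v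
  have key : ∀ e ∈ Γ.incidenceSet v, ∃ x, e = s(v, x) := fun e he => by
    obtain ⟨x, rfl⟩ := Sym2.mem_iff_exists.1 he.2
    exact ⟨x, rfl⟩
  obtain ⟨x, rfl⟩ := key e₁ (by simp [hinc])
  obtain ⟨y, rfl⟩ := key e₂ (by simp [hinc])
  obtain ⟨z, rfl⟩ := key e₃ (by simp [hinc])
  refine ⟨x, y, z, ⟨by grind, by grind, by grind, fun w => ?_⟩, ha, hb, hc⟩
  rw [← SimpleGraph.mem_incidenceSet, hinc]
  simp only [Set.mem_insert_iff, Set.mem_singleton_iff, Sym2.congr_right]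

end Counting

section LocalStructure

variable {V : Type*} {Γ : SimpleGraph V}

open Classical in
lemma HasNeighbors.exists_linked_not_linked {a m x x' y : V} (h : HasNeighbors Γ a m x x')
    (hsum : (if Linked Γ x y then 1 else 0) + (if Linked Γ x' y then 1 else 0) = 1) :
    ∃ p p', HasNeighbors Γ a m p p' ∧ Linked Γ p y ∧ ¬ Linked Γ p' y := by
  by_cases h1 : Linked Γ x y <;> by_cases h2 : Linked Γ x' y <;> simp only [h1, h2] at hsum
  · simp at hsum
  · exact ⟨_, _, h, h1, h2⟩
  · exact ⟨_, _, h.swap, h2, h1⟩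
  · simp at hsum

open Classical in
lemma linked_of_sum_eq_two {x x' y : V}
    (hsum : (if Linked Γ x y then 1 else 0) + (if Linked Γ x' y then 1 else 0) = 2) :
    Linked Γ x y ∧ Linked Γ x' y := by
  by_cases h1 : Linked Γ x y <;> by_cases h2 : Linked Γ x' y <;> simp_all

/-- The ball of radius 2 around the edge `u v`. -/
structure EdgeBall (Γ : SimpleGraph V) (u v u₀ u₁ v₀ v₁ u₀₀ u₀₁ u₁₀ u₁₁ v₀₀ v₀₁ v₁₀ v₁₁ : V) :
    Prop where
  nu : HasNeighbors Γ u v u₀ u₁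
  nv : HasNeighbors Γ v u v₀ v₁
  nu₀ : HasNeighbors Γ u₀ u u₀₀ u₀₁
  nu₁ : HasNeighbors Γ u₁ u u₁₀ u₁₁
  nv₀ : HasNeighbors Γ v₀ v v₀₀ v₀₁
  nv₁ : HasNeighbors Γ v₁ v v₁₀ v₁₁

lemma EdgeBall.nodup (hg : GirthGeSix Γ) {u v u₀ u₁ v₀ v₁ u₀₀ u₀₁ u₁₀ u₁₁ v₀₀ v₀₁ v₁₀ v₁₁ : V}
    (h : EdgeBall Γ u v u₀ u₁ v₀ v₁ u₀₀ u₀₁ u₁₀ u₁₁ v₀₀ v₀₁ v₁₀ v₁₁) :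
    [u, v, u₀, u₁, v₀, v₁, u₀₀, u₀₁, u₁₀, u₁₁, v₀₀, v₀₁, v₁₀, v₁₁].Nodup := by
  obtain ⟨nu, nv, nu₀, nu₁, nv₀, nv₁⟩ := h
  have := nu.ne₁₂
  have := nu.ne₁₃
  have := nu.ne₂₃
  have := nv.ne₁₂
  have := nv.ne₁₃
  have := nv.ne₂₃
  have := nu₀.ne₁₂
  have := nu₀.ne₁₃
  have := nu₀.ne₂₃
  have := nu₁.ne₁₂
  have := nu₁.ne₁₃
  have := nu₁.ne₂₃
  have := nv₀.ne₁₂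
  have := nv₀.ne₁₃
  have := nv₀.ne₂₃
  have := nv₁.ne₁₂
  have := nv₁.ne₁₃
  have := nv₁.ne₂₃
  have := nu.adj₁
  have := nu.adj₂
  have := nu.adj₃
  have := nv.adj₂
  have := nv.adj₃
  have := nu₀.adj₂
  have := nu₀.adj₃
  have := nu₁.adj₂
  have := nu₁.adj₃
  have := nv₀.adj₂
  have := nv₀.adj₃
  have := nv₁.adj₂
  have := nv₁.adj₃
  have t3 : ∀ x y z w, Γ.Adj x y → Γ.Adj x z → Γ.Adj z w → y ≠ w := by
    rintro x y z _ h1 h2 h3 rfl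
    exact hg.no_three _ _ _ h2 h3 h1.symm
  have t3' : ∀ x y z w, Γ.Adj x y → Γ.Adj y z → Γ.Adj z w → x ≠ w := by
    rintro x y z _ h1 h2 h3 rfl
    exact hg.no_three _ _ _ h1 h2 h3
  have t4 : ∀ a x y p q, Γ.Adj a x → Γ.Adj a y → Γ.Adj x p → Γ.Adj y q → x ≠ y → a ≠ p →
      p ≠ q := by
    rintro a x y p _ h1 h2 h3 h4 hxy hap rfl
    exact (hg.no_four _ _ _ _ h1 h3 h4.symm h2.symm).elim hap hxy
  have t4' : ∀ x y p, Γ.Adj u x → x ≠ v → Γ.Adj v y → Γ.Adj y p → y ≠ u → x ≠ p := by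
    rintro x y _ h1 h2 h3 h4 h5 rfl
    exact (hg.no_four _ _ _ _ nu.adj₁ h3 h4 h1.symm).elim h5.symm h2.symm
  have t4'' : ∀ x y p, Γ.Adj v x → x ≠ u → Γ.Adj u y → Γ.Adj y p → y ≠ v → x ≠ p := by
    rintro x y _ h1 h2 h3 h4 h5 rfl
    exact (hg.no_four _ _ _ _ nu.adj₁.symm h3 h4 h1.symm).elim h5.symm h2.symm
  have t5 : ∀ x y p q, Γ.Adj u x → Γ.Adj v y → Γ.Adj x p → Γ.Adj y q → p ≠ q := by
    rintro x y p _ h1 h2 h3 h4 rfl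
    exact hg.no_five _ _ _ _ _ h1 h3 h4.symm h2.symm nu.adj₁.symm
  simp only [List.nodup_cons, List.mem_cons, not_or, List.not_mem_nil, not_false_eq_true,
    List.nodup_nil, and_true]
  refine ⟨⟨?_, ?_, ?_, ?_, ?_, ?_, ?_, ?_, ?_, ?_, ?_, ?_, ?_⟩,
    ⟨?_, ?_, ?_, ?_, ?_, ?_, ?_, ?_, ?_, ?_, ?_, ?_⟩,
    ⟨?_, ?_, ?_, ?_, ?_, ?_, ?_, ?_, ?_, ?_, ?_⟩,
    ⟨?_, ?_, ?_, ?_, ?_, ?_, ?_, ?_, ?_, ?_⟩, ⟨?_, ?_, ?_, ?_, ?_, ?_, ?_, ?_, ?_⟩,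
    ⟨?_, ?_, ?_, ?_, ?_, ?_, ?_, ?_⟩, ⟨?_, ?_, ?_, ?_, ?_, ?_, ?_⟩, ⟨?_, ?_, ?_, ?_, ?_, ?_⟩,
    ⟨?_, ?_, ?_, ?_, ?_⟩, ⟨?_, ?_, ?_, ?_⟩, ⟨?_, ?_, ?_⟩, ⟨?_, ?_⟩, ?_⟩ <;>
  first | assumption | exact SimpleGraph.Adj.ne ‹_› | grind only

end LocalStructure

section TypeTwo

variable {V : Type*} {Γ : SimpleGraph V}

/-- If the paths `u₀ u v` and `v₀ v u` were contained in 4 hexagons, then some vertex would be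
the midpoint of two paths in at least 3 hexagons. -/
lemma false_of_hexCount_four_two (hg : GirthGeSix Γ)
    (hcubic : ∀ v : V, (Γ.neighborSet v).ncard = 3) {u v u₀ u₁ v₀ v₁ : V}
    (nu : HasNeighbors Γ u v u₀ u₁) (nv : HasNeighbors Γ v u v₀ v₁)
    (hu₀ : hexCount Γ u₀ u v = 4) (hv₀ : hexCount Γ v₀ v u = 4)
    (hq : ∀ m p q r, HasNeighbors Γ m p q r →
      ¬ (3 ≤ hexCount Γ p m q ∧ 3 ≤ hexCount Γ p m r)) : False := by
  classical
  obtain ⟨u₀₀, u₀₁, nu₀⟩ := exists_hasNeighbors_of_adj hcubic nu.adj₂.symm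
  obtain ⟨u₁₀, u₁₁, nu₁⟩ := exists_hasNeighbors_of_adj hcubic nu.adj₃.symm
  obtain ⟨v₀₀, v₀₁, nv₀⟩ := exists_hasNeighbors_of_adj hcubic nv.adj₂.symm
  obtain ⟨v₁₀, v₁₁, nv₁⟩ := exists_hasNeighbors_of_adj hcubic nv.adj₃.symm
  rw [hexCount_eq_sum nu₀ nv] at hu₀
  rw [hexCount_eq_sum nv₀ nu] at hv₀
  have c00 := linked_sum_comm hg nu.adj₁ nu₀ nv₀ nu.ne₁₂.symm nv.ne₁₂.symm
  have c01 := linked_sum_comm hg nu.adj₁ nu₀ nv₁ nu.ne₁₂.symm nv.ne₁₃.symm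
  have c10 := linked_sum_comm hg nu.adj₁ nu₁ nv₀ nu.ne₁₃.symm nv.ne₁₂.symm
  have c11 := linked_sum_comm hg nu.adj₁ nu₁ nv₁ nu.ne₁₃.symm nv.ne₁₃.symm
  obtain ⟨la, lb⟩ : Linked Γ u₀₀ v₀ ∧ Linked Γ u₀₁ v₀ := by grind
  obtain ⟨lc, ld⟩ : Linked Γ u₀₀ v₁ ∧ Linked Γ u₀₁ v₁ := by grind
  obtain ⟨le, lf⟩ : Linked Γ v₀₀ u₁ ∧ Linked Γ v₀₁ u₁ := by grind
  have key : ∀ x, Γ.Adj u₀ x → x ≠ u → Linked Γ x v₀ → Linked Γ x v₁ →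
      3 ≤ hexCount Γ u u₀ x := by
    intro x hx hxu h0 h1
    have far : ¬ Γ.Adj x v := fun h =>
      (hg.no_four _ _ _ _ hx h nu.adj₁.symm nu.adj₂).elim nu.ne₁₂.symm hxu
    obtain ⟨y, hy, hy'⟩ := h0
    obtain ⟨z, hz, hz'⟩ := h1
    have hyv : y ≠ v := by rintro rfl; exact far hy
    have hzv : z ≠ v := by rintro rfl; exact far hz
    have hyu : Linked Γ y u₁ := by
      rcases (nv₀.adj_iff y).1 hy'.symm with rfl | rfl | rfl
      exacts [absurd rfl hyv, le, lf]
    have hyz : y ≠ z := by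
      rintro rfl
      exact (hg.no_four _ _ _ _ hy' nv.adj₂.symm nv.adj₃ hz'.symm).elim hyv nv.ne₂₃
    have hyu₀ : u₀ ≠ y := by
      rintro rfl
      exact (hg.no_four _ _ _ _ hy' nv.adj₂.symm nu.adj₁.symm nu.adj₂).elim nu.ne₁₂.symm
        nv.ne₁₂.symm
    have hzu₀ : u₀ ≠ z := by
      rintro rfl
      exact (hg.no_four _ _ _ _ hz' nv.adj₃.symm nu.adj₁.symm nu.adj₂).elim nu.ne₁₂.symm
        nv.ne₁₃.symm
    obtain ⟨t, nx⟩ := exists_hasNeighbors_of_adj₂ hcubic hx.symm hy hyu₀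
    have hzt : z = t := by
      rcases (nx.adj_iff z).1 hz with h | h | h
      exacts [absurd h hzu₀.symm, absurd h.symm hyz, h]
    subst hzt
    rw [hexCount_eq_sum nu.swap.rotate.rotate nx, if_pos hyu.symm,
      if_pos (show Linked Γ v y from ⟨_, nv.adj₂, hy'.symm⟩),
      if_pos (show Linked Γ v z from ⟨_, nv.adj₃, hz'.symm⟩)]
    split_ifs <;> simp
  exact hq _ _ _ _ nu₀ ⟨key _ nu₀.adj₂ nu₀.ne₁₂.symm la lc, key _ nu₀.adj₃ nu₀.ne₁₃.symm lb ld⟩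

end TypeTwo

section TypeOne

variable {V : Type*} {Γ : SimpleGraph V}

/-- The adjacencies forced around an edge `u v` of which every extension to a path of length 2 lies
on 3 hexagons. -/
structure HexCore (Γ : SimpleGraph V)
    (u v u₀ u₁ v₀ v₁ u₀₀ u₀₁ u₁₀ u₁₁ v₀₀ v₀₁ v₁₀ v₁₁ w₀ w₁ z₀ z₁ : V) : Prop
    extends EdgeBall Γ u v u₀ u₁ v₀ v₁ u₀₀ u₀₁ u₁₀ u₁₁ v₀₀ v₀₁ v₁₀ v₁₁ where
  nu₀₀ : HasNeighbors Γ u₀₀ u₀ v₁₀ v₀₁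
  nu₁₀ : HasNeighbors Γ u₁₀ u₁ v₀₀ v₁₁
  nv₀₀ : HasNeighbors Γ v₀₀ v₀ u₁₀ u₀₁
  nv₁₀ : HasNeighbors Γ v₁₀ v₁ u₀₀ u₁₁
  nu₀₁ : HasNeighbors Γ u₀₁ u₀ v₀₀ w₀
  nu₁₁ : HasNeighbors Γ u₁₁ u₁ v₁₀ w₁
  nv₀₁ : HasNeighbors Γ v₀₁ v₀ u₀₀ z₀
  nv₁₁ : HasNeighbors Γ v₁₁ v₁ u₁₀ z₁
  not_linked_u₀₁ : ¬ Linked Γ u₀₁ v₁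
  not_linked_u₁₁ : ¬ Linked Γ u₁₁ v₀
  not_linked_v₀₁ : ¬ Linked Γ v₀₁ u₁
  not_linked_v₁₁ : ¬ Linked Γ v₁₁ u₀

open Classical in
lemma exists_linkPattern (hg : GirthGeSix Γ)
    (hcubic : ∀ v : V, (Γ.neighborSet v).ncard = 3) {u v u₀ u₁ v₀ v₁ : V}
    (nu : HasNeighbors Γ u v u₀ u₁) (nv : HasNeighbors Γ v u v₀ v₁)
    (hu₀ : hexCount Γ u₀ u v = 3) (hu₁ : hexCount Γ u₁ u v = 3)
    (hv₀ : hexCount Γ v₀ v u = 3) (hv₁ : hexCount Γ v₁ v u = 3) :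
    ∃ v₀ v₁ u₀₀ u₀₁ u₁₀ u₁₁ v₀₀ v₀₁ v₁₀ v₁₁,
      EdgeBall Γ u v u₀ u₁ v₀ v₁ u₀₀ u₀₁ u₁₀ u₁₁ v₀₀ v₀₁ v₁₀ v₁₁ ∧
      (Linked Γ u₀₀ v₀ ∧ Linked Γ u₀₁ v₀ ∧ Linked Γ u₀₀ v₁ ∧ ¬ Linked Γ u₀₁ v₁) ∧
      (Linked Γ u₁₀ v₁ ∧ Linked Γ u₁₁ v₁ ∧ Linked Γ u₁₀ v₀ ∧ ¬ Linked Γ u₁₁ v₀) ∧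
      (Linked Γ v₀₀ u₀ ∧ Linked Γ v₀₁ u₀ ∧ Linked Γ v₀₀ u₁ ∧ ¬ Linked Γ v₀₁ u₁) ∧
      (Linked Γ v₁₀ u₁ ∧ Linked Γ v₁₁ u₁ ∧ Linked Γ v₁₀ u₀ ∧ ¬ Linked Γ v₁₁ u₀) := by
  obtain ⟨a, a', na⟩ := exists_hasNeighbors_of_adj hcubic nu.adj₂.symm
  obtain ⟨b, b', nb⟩ := exists_hasNeighbors_of_adj hcubic nu.adj₃.symm
  wlog hlt : (if Linked Γ a v₀ then 1 else 0) + (if Linked Γ a' v₀ then 1 else 0) = 2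
      generalizing v₀ v₁
  · refine this nv.swap hv₁ hv₀ ?_
    rw [hexCount_eq_sum na nv] at hu₀
    grind
  obtain ⟨c, c', nc⟩ := exists_hasNeighbors_of_adj hcubic nv.adj₂.symm
  obtain ⟨d, d', nd⟩ := exists_hasNeighbors_of_adj hcubic nv.adj₃.symm
  rw [hexCount_eq_sum na nv] at hu₀
  rw [hexCount_eq_sum nb nv] at hu₁
  rw [hexCount_eq_sum nc nu] at hv₀
  rw [hexCount_eq_sum nd nu] at hv₁
  have c00 := linked_sum_comm hg nu.adj₁ na nc nu.ne₁₂.symm nv.ne₁₂.symm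
  have c01 := linked_sum_comm hg nu.adj₁ na nd nu.ne₁₂.symm nv.ne₁₃.symm
  have c10 := linked_sum_comm hg nu.adj₁ nb nc nu.ne₁₃.symm nv.ne₁₂.symm
  have c11 := linked_sum_comm hg nu.adj₁ nb nd nu.ne₁₃.symm nv.ne₁₃.symm
  obtain ⟨u₀₀, u₀₁, nu₀, l1, l2⟩ := na.exists_linked_not_linked (y := v₁) (by omega)
  obtain ⟨u₁₀, u₁₁, nu₁, l3, l4⟩ := nb.exists_linked_not_linked (y := v₀) (by omega)
  obtain ⟨v₀₀, v₀₁, nv₀, l5, l6⟩ := nc.exists_linked_not_linked (y := u₁) (by omega)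
  obtain ⟨v₁₀, v₁₁, nv₁, l7, l8⟩ := nd.exists_linked_not_linked (y := u₀) (by omega)
  have e00 := linked_sum_comm hg nu.adj₁ nu₀ nv₀ nu.ne₁₂.symm nv.ne₁₂.symm
  have e00' := linked_sum_comm hg nu.adj₁ nu₀ nc nu.ne₁₂.symm nv.ne₁₂.symm
  have e11 := linked_sum_comm hg nu.adj₁ nu₁ nv₁ nu.ne₁₃.symm nv.ne₁₃.symm
  have e11' := linked_sum_comm hg nu.adj₁ nu₁ nd nu.ne₁₃.symm nv.ne₁₃.symm
  obtain ⟨m1, m2⟩ := linked_of_sum_eq_two (e00'.trans (c00.symm.trans hlt))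
  obtain ⟨m3, m4⟩ := linked_of_sum_eq_two (e00.symm.trans (e00'.trans (c00.symm.trans hlt)))
  have h11 : (if Linked Γ b v₁ then 1 else 0) + (if Linked Γ b' v₁ then 1 else 0) = 2 := by omega
  obtain ⟨m5, m6⟩ := linked_of_sum_eq_two (e11'.trans (c11.symm.trans h11))
  obtain ⟨m7, m8⟩ := linked_of_sum_eq_two (e11.symm.trans (e11'.trans (c11.symm.trans h11)))
  exact ⟨v₀, v₁, u₀₀, u₀₁, u₁₀, u₁₁, v₀₀, v₀₁, v₁₀, v₁₁, ⟨nu, nv, nu₀, nu₁, nv₀, nv₁⟩,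
    ⟨m1, m2, l1, l2⟩, ⟨m5, m6, l3, l4⟩, ⟨m3, m4, l5, l6⟩, ⟨m7, m8, l7, l8⟩⟩

lemma HasNeighbors.adj_of_linked {v₁ v y y' x : V} (h : HasNeighbors Γ v₁ v y y')
    (hl : Linked Γ x v₁) (hx : ¬ Γ.Adj x v) : Γ.Adj x y ∨ Γ.Adj x y' := by
  obtain ⟨t, h1, h2⟩ := hl
  rcases (h.adj_iff t).1 h2.symm with rfl | rfl | rfl
  exacts [absurd h1 hx, .inl h1, .inr h1]

lemma hasNeighbors_of_adj (hcubic : ∀ v : V, (Γ.neighborSet v).ncard = 3) {v x y z : V}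
    (hx : Γ.Adj v x) (hy : Γ.Adj v y) (hz : Γ.Adj v z) (hxy : x ≠ y) (hxz : x ≠ z) (hyz : y ≠ z) :
    HasNeighbors Γ v x y z := by
  obtain ⟨c, hv⟩ := exists_hasNeighbors_of_adj₂ hcubic hx hy hxy
  rcases (hv.adj_iff z).1 hz with rfl | rfl | rfl
  exacts [absurd rfl hxz, absurd rfl hyz, hv]

lemma exists_hexCore (hg : GirthGeSix Γ)
    (hcubic : ∀ v : V, (Γ.neighborSet v).ncard = 3)
    (hle : ∀ m p q r, HasNeighbors Γ m p q r → hexCount Γ p m q ≤ 3) {u v u₀ u₁ v₀ v₁ : V}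
    (nu : HasNeighbors Γ u v u₀ u₁) (nv : HasNeighbors Γ v u v₀ v₁)
    (hu₀ : hexCount Γ u₀ u v = 3) (hu₁ : hexCount Γ u₁ u v = 3)
    (hv₀ : hexCount Γ v₀ v u = 3) (hv₁ : hexCount Γ v₁ v u = 3) :
    ∃ v₀ v₁ u₀₀ u₀₁ u₁₀ u₁₁ v₀₀ v₀₁ v₁₀ v₁₁ w₀ w₁ z₀ z₁,
      HexCore Γ u v u₀ u₁ v₀ v₁ u₀₀ u₀₁ u₁₀ u₁₁ v₀₀ v₀₁ v₁₀ v₁₁ w₀ w₁ z₀ z₁ := by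
  obtain ⟨v₀, v₁, u₀₀, u₀₁, u₁₀, u₁₁, v₀₀, v₀₁, v₁₀, v₁₁, hB, ⟨a1, a2, a3, a4⟩, ⟨b1, b2, b3, b4⟩,
    ⟨c1, c2, c3, c4⟩, ⟨d1, d2, d3, d4⟩⟩ := exists_linkPattern hg hcubic nu nv hu₀ hu₁ hv₀ hv₁
  have hnd := hB.nodup hg
  obtain ⟨nu, nv, nu₀, nu₁, nv₀, nv₁⟩ := hB
  simp only [List.nodup_cons, List.mem_cons, not_or, List.not_mem_nil, not_false_eq_true,
    List.nodup_nil, and_true] at hnd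
  have far : ∀ {u₀ x}, Γ.Adj u u₀ → u₀ ≠ v → Γ.Adj u₀ x → x ≠ u → ¬ Γ.Adj x v :=
    fun h h' h1 h2 h3 => (hg.no_four _ _ _ _ h h1 h3 nu.adj₁.symm).elim h2.symm h'
  have f00 := far nu.adj₂ nu.ne₁₂.symm nu₀.adj₂ nu₀.ne₁₂.symm
  have f01 := far nu.adj₂ nu.ne₁₂.symm nu₀.adj₃ nu₀.ne₁₃.symm
  have f10 := far nu.adj₃ nu.ne₁₃.symm nu₁.adj₂ nu₁.ne₁₂.symm
  have f11 := far nu.adj₃ nu.ne₁₃.symm nu₁.adj₃ nu₁.ne₁₃.symm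
  have g1 : Γ.Adj u₀₀ v₁₀ := (nv₁.adj_of_linked a3 f00).resolve_right
    fun h => d4 ⟨_, h.symm, nu₀.adj₂.symm⟩
  have g2 : Γ.Adj u₁₀ v₀₀ := (nv₀.adj_of_linked b3 f10).resolve_right
    fun h => c4 ⟨_, h.symm, nu₁.adj₂.symm⟩
  have g3 : Γ.Adj u₀₀ v₀₁ := by
    refine (nv₀.adj_of_linked a1 f00).resolve_left fun h => ?_
    have n : HasNeighbors Γ u₀₀ u₀ v₀₀ v₁₀ :=
      hasNeighbors_of_adj hcubic nu₀.adj₂.symm h g1 (by grind) (by grind) (by grind)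
    have := hle _ _ _ _ nu₀
    rw [hexCount_eq_sum nu.swap.rotate.rotate n, if_pos c3.symm, if_pos d1.symm,
      if_pos (show Linked Γ v v₀₀ from ⟨_, nv.adj₂, nv₀.adj₂⟩),
      if_pos (show Linked Γ v v₁₀ from ⟨_, nv.adj₃, nv₁.adj₂⟩)] at this
    omega
  have g4 : Γ.Adj u₁₀ v₁₁ := by
    refine (nv₁.adj_of_linked b1 f10).resolve_left fun h => ?_
    have n : HasNeighbors Γ u₁₀ u₁ v₀₀ v₁₀ :=
      hasNeighbors_of_adj hcubic nu₁.adj₂.symm g2 h (by grind) (by grind) (by grind)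
    have := hle _ _ _ _ nu₁
    rw [hexCount_eq_sum nu.rotate.rotate n, if_pos c1.symm, if_pos d3.symm,
      if_pos (show Linked Γ v v₀₀ from ⟨_, nv.adj₂, nv₀.adj₂⟩),
      if_pos (show Linked Γ v v₁₀ from ⟨_, nv.adj₃, nv₁.adj₂⟩)] at this
    omega
  have g5 : Γ.Adj u₀₁ v₀₀ := by
    refine (nv₀.adj_of_linked a2 f01).resolve_right fun h => ?_
    exact (hg.no_four _ _ _ _ h g3.symm nu₀.adj₂.symm nu₀.adj₃).elim nu₀.ne₂₃.symm (by grind)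
  have g6 : Γ.Adj u₁₁ v₁₀ := by
    refine (nv₁.adj_of_linked b2 f11).resolve_right fun h => ?_
    exact (hg.no_four _ _ _ _ h g4.symm nu₁.adj₂.symm nu₁.adj₃).elim nu₁.ne₂₃.symm (by grind)
  obtain ⟨w₀, n₁⟩ :=
    exists_hasNeighbors_of_adj₂ hcubic nu₀.adj₃.symm g5 (by grind)
  obtain ⟨w₁, n₂⟩ :=
    exists_hasNeighbors_of_adj₂ hcubic nu₁.adj₃.symm g6 (by grind)
  obtain ⟨z₀, n₃⟩ :=
    exists_hasNeighbors_of_adj₂ hcubic nv₀.adj₃.symm g3.symm (by grind)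
  obtain ⟨z₁, n₄⟩ :=
    exists_hasNeighbors_of_adj₂ hcubic nv₁.adj₃.symm g4.symm (by grind)
  exact ⟨v₀, v₁, u₀₀, u₀₁, u₁₀, u₁₁, v₀₀, v₀₁, v₁₀, v₁₁, w₀, w₁, z₀, z₁,
    ⟨nu, nv, nu₀, nu₁, nv₀, nv₁⟩,
    hasNeighbors_of_adj hcubic nu₀.adj₂.symm g1 g3 (by grind) (by grind) (by grind),
    hasNeighbors_of_adj hcubic nu₁.adj₂.symm g2 g4 (by grind) (by grind) (by grind),
    hasNeighbors_of_adj hcubic nv₀.adj₂.symm g2.symm g5.symm (by grind) (by grind) (by grind),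
    hasNeighbors_of_adj hcubic nv₁.adj₂.symm g1.symm g6.symm (by grind) (by grind) (by grind),
    n₁, n₂, n₃, n₄, a4, b4, c4, d4⟩

lemma HexCore.symm {u v u₀ u₁ v₀ v₁ u₀₀ u₀₁ u₁₀ u₁₁ v₀₀ v₀₁ v₁₀ v₁₁ w₀ w₁ z₀ z₁ : V}
    (h : HexCore Γ u v u₀ u₁ v₀ v₁ u₀₀ u₀₁ u₁₀ u₁₁ v₀₀ v₀₁ v₁₀ v₁₁ w₀ w₁ z₀ z₁) :
    HexCore Γ v u v₀ v₁ u₀ u₁ v₀₀ v₀₁ v₁₀ v₁₁ u₀₀ u₀₁ u₁₀ u₁₁ z₀ z₁ w₀ w₁ :=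
  ⟨⟨h.nv, h.nu, h.nv₀, h.nv₁, h.nu₀, h.nu₁⟩, h.nv₀₀, h.nv₁₀, h.nu₀₀, h.nu₁₀, h.nv₀₁, h.nv₁₁,
    h.nu₀₁, h.nu₁₁, h.not_linked_v₀₁, h.not_linked_v₁₁,
    h.not_linked_u₀₁, h.not_linked_u₁₁⟩

/-- If `u₀ u u₁` lies on three hexagons, then the outer vertices attached to `u₀` and `u₁`
coincide. -/
lemma HexCore.eq_of_hexCount (hg : GirthGeSix Γ)
    {u v u₀ u₁ v₀ v₁ u₀₀ u₀₁ u₁₀ u₁₁ v₀₀ v₀₁ v₁₀ v₁₁ w₀ w₁ z₀ z₁ : V}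
    (h : HexCore Γ u v u₀ u₁ v₀ v₁ u₀₀ u₀₁ u₁₀ u₁₁ v₀₀ v₀₁ v₁₀ v₁₁ w₀ w₁ z₀ z₁)
    (h3 : hexCount Γ u₀ u u₁ = 3) : w₀ = w₁ := by
  classical
  have hnd := h.nodup hg
  simp only [List.nodup_cons, List.mem_cons, not_or, List.not_mem_nil, not_false_eq_true,
    List.nodup_nil, and_true] at hnd
  have l1 : ¬ Linked Γ u₀₀ u₁₀ := by
    rw [h.nu₀₀.linked_iff]
    simp only [Γ.adj_comm _ u₁₀, h.nu₁₀.adj_iff]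
    grind
  rw [hexCount_eq_sum h.nu₀ h.nu₁, if_neg l1] at h3
  obtain ⟨t, ht, ht'⟩ : Linked Γ u₀₁ u₁₁ := by grind
  have e1 : t ≠ v₀₀ := by
    rintro rfl
    exact h.not_linked_u₁₁ ⟨_, ht'.symm, h.nv₀.adj₂.symm⟩
  have e2 : t ≠ v₁₀ := by
    rintro rfl
    exact h.not_linked_u₀₁ ⟨_, ht, h.nv₁.adj₂.symm⟩
  have e3 : t ≠ u₀ := by
    rintro rfl
    rw [h.nu₀.adj_iff] at ht'
    grind
  have e4 : t ≠ u₁ := by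
    rintro rfl
    rw [Γ.adj_comm, h.nu₁.adj_iff] at ht
    grind
  have := (h.nu₀₁.adj_iff t).1 ht
  have := (h.nu₁₁.adj_iff t).1 ht'.symm
  grind

/-- If `u v` is the only edge at `u` all of whose extensions lie on three hexagons, then the
edge `u₀ u₀₀` cannot have the same property. -/
lemma HexCore.hexCount_lt (hg : GirthGeSix Γ)
    {u v u₀ u₁ v₀ v₁ u₀₀ u₀₁ u₁₀ u₁₁ v₀₀ v₀₁ v₁₀ v₁₁ w₀ w₁ z₀ z₁ : V}
    (h : HexCore Γ u v u₀ u₁ v₀ v₁ u₀₀ u₀₁ u₁₀ u₁₁ v₀₀ v₀₁ v₁₀ v₁₁ w₀ w₁ z₀ z₁)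
    (h3 : hexCount Γ u₀ u u₁ < 3) :
    hexCount Γ u₀₁ u₀ u₀₀ < 3 ∧ 3 ≤ hexCount Γ u u₀ u₀₀ := by
  classical
  have hnd := h.nodup hg
  simp only [List.nodup_cons, List.mem_cons, not_or, List.not_mem_nil, not_false_eq_true,
    List.nodup_nil, and_true] at hnd
  have l1 : ¬ Linked Γ v₀₀ v₁₀ := by
    rw [h.nv₀₀.linked_iff]
    simp only [Γ.adj_comm _ v₁₀, h.nv₁₀.adj_iff]
    grind
  have l2 : ¬ Linked Γ u₀₁ u₁₁ := by
    intro hl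
    rw [hexCount_eq_sum h.nu₀ h.nu₁, if_pos hl,
      if_pos (show Linked Γ u₀₀ u₁₁ from ⟨_, h.nu₀₀.adj₂, h.nv₁₀.adj₃⟩),
      if_pos (show Linked Γ u₀₁ u₁₀ from ⟨_, h.nu₀₁.adj₂, h.nv₀₀.adj₂⟩)] at h3
    omega
  have l3 : ¬ Linked Γ w₀ v₁₀ := by
    rintro ⟨t, ht, ht'⟩
    rcases (h.nv₁₀.adj_iff t).1 ht'.symm with rfl | rfl | rfl
    · exact h.not_linked_u₀₁ ⟨_, h.nu₀₁.adj₃, ht⟩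
    · refine (hg.no_four _ _ _ _ h.nu₀₁.adj₃ ht h.nu₀.adj₂.symm h.nu₀.adj₃).elim (by grind) ?_
      exact h.nu₀₁.ne₁₃.symm
    · exact l2 ⟨_, h.nu₀₁.adj₃, ht⟩
  constructor
  · rw [hexCount_eq_sum h.nu₀₁ h.nu₀₀, if_neg l1, if_neg l3]
    split_ifs <;> simp
  · rw [hexCount_eq_sum h.nu.swap.rotate.rotate h.nu₀₀,
      if_pos (show Linked Γ v v₁₀ from ⟨_, h.nv.adj₃, h.nv₁.adj₂⟩),
      if_pos (show Linked Γ v v₀₁ from ⟨_, h.nv.adj₂, h.nv₀.adj₃⟩),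
      if_pos (show Linked Γ u₁ v₁₀ from ⟨_, h.nu₁.adj₃, h.nu₁₁.adj₂⟩)]
    split_ifs <;> simp

end TypeOne

section Closing

variable {V : Type*} {Γ : SimpleGraph V}

lemma HexCore.outer_ne (hg : GirthGeSix Γ)
    {u v u₀ u₁ v₀ v₁ u₀₀ u₀₁ u₁₀ u₁₁ v₀₀ v₀₁ v₁₀ v₁₁ w z : V}
    (h : HexCore Γ u v u₀ u₁ v₀ v₁ u₀₀ u₀₁ u₁₀ u₁₁ v₀₀ v₀₁ v₁₀ v₁₁ w w z z) :
    ∀ x ∈ [u, v, u₀, u₁, v₀, v₁, u₀₀, u₀₁, u₁₀, u₁₁, v₀₀, v₀₁, v₁₀, v₁₁], z ≠ x := by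
  have hnd := h.nodup hg
  simp only [List.nodup_cons, List.mem_cons, not_or, List.not_mem_nil, not_false_eq_true,
    List.nodup_nil, and_true] at hnd
  have a1 := h.nv₀₁.adj₃
  have a2 := h.nv₁₁.adj₃
  intro x hx hzx
  subst hzx
  simp only [List.mem_cons, List.not_mem_nil, or_false] at hx
  have b1 := a1.symm
  have b2 := a2.symm
  rcases hx with rfl | rfl | rfl | rfl | rfl | rfl | rfl | rfl | rfl | rfl | rfl | rfl | rfl | rfl
  · rw [h.nu.adj_iff] at b1; grind only
  · rw [h.nv.adj_iff] at b1 b2; grind only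
  · rw [h.nu₀.adj_iff] at b1; grind only
  · rw [h.nu₁.adj_iff] at b1; grind only
  · rw [h.nv₀.adj_iff] at b2; grind only
  · rw [h.nv₁.adj_iff] at b1; grind only
  · rw [h.nu₀₀.adj_iff] at b2; grind only
  · rw [h.nu₀₁.adj_iff] at b1 b2; grind only
  · rw [h.nu₁₀.adj_iff] at b1; grind only
  · rw [h.nu₁₁.adj_iff] at b1 b2; grind only
  · rw [h.nv₀₀.adj_iff] at b1; grind only
  · exact b1.ne rfl
  · rw [h.nv₁₀.adj_iff] at b1; grind only
  · exact b2.ne rfl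

/-- If all paths of length 2 lie on three hexagons, the two outer vertices are adjacent. -/
lemma HexCore.adj_outer (hg : GirthGeSix Γ) (hcubic : ∀ v : V, (Γ.neighborSet v).ncard = 3)
    (hall : ∀ m p q r, HasNeighbors Γ m p q r → hexCount Γ p m q = 3)
    {u v u₀ u₁ v₀ v₁ u₀₀ u₀₁ u₁₀ u₁₁ v₀₀ v₀₁ v₁₀ v₁₁ w z : V}
    (h : HexCore Γ u v u₀ u₁ v₀ v₁ u₀₀ u₀₁ u₁₀ u₁₁ v₀₀ v₀₁ v₁₀ v₁₁ w w z z) : Γ.Adj w z := by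
  classical
  have hz := h.outer_ne hg
  have a1 := h.nv₀₁.adj₃
  have a2 := h.nv₁₁.adj₃
  obtain ⟨t, nz⟩ := exists_hasNeighbors_of_adj₂ hcubic a1.symm a2.symm (by
    have hnd := h.nodup hg
    simp only [List.nodup_cons, List.mem_cons, not_or] at hnd
    exact hnd.2.2.2.2.2.2.2.2.2.2.2.1.2.1)
  obtain ⟨y, y', nt⟩ := exists_hasNeighbors_of_adj hcubic nz.adj₃.symm
  simp only [List.mem_cons, List.not_mem_nil, or_false, forall_eq_or_imp, forall_eq] at hz
  have key : ∀ x y, Γ.Adj v₁₁ x → x ≠ z → Γ.Adj t y → y ≠ z → Linked Γ x y → t = w := by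
    rintro x y hx hxz hty hyz ⟨q, hxq, hqy⟩
    have hq : q ≠ v₁₁ := by
      rintro rfl
      exact (hg.no_four _ _ _ _ hqy hty.symm nz.adj₃.symm a2.symm).elim nz.ne₂₃ hyz
    have htz := nz.adj₃.symm
    have hyt := hty.symm
    rw [h.nv₁₁.adj_iff] at hx
    have hq' : q = v ∨ q = v₁₀ ∨ q = u₁ ∨ q = v₀₀ := by
      rcases hx with rfl | rfl | rfl
      · rw [h.nv₁.adj_iff] at hxq; grind only
      · rw [h.nu₁₀.adj_iff] at hxq; grind only
      · exact absurd rfl hxz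
    have hy : y = u ∨ y = v₀ ∨ y = v₁ ∨ y = u₀₀ ∨ y = u₁₁ ∨ y = u₁₀ ∨ y = u₀₁ := by
      rcases hq' with rfl | rfl | rfl | rfl
      · rw [h.nv.adj_iff] at hqy; grind only
      · rw [h.nv₁₀.adj_iff] at hqy; grind only
      · rw [h.nu₁.adj_iff] at hqy; grind only
      · rw [h.nv₀₀.adj_iff] at hqy; grind only
    have ht : t = w ∨ t = v ∨ t = u₀ ∨ t = u₁ ∨ t = v₀₀ ∨ t = v₁₀ := by
      have := nz.ne₁₃
      have := nz.ne₂₃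
      rcases hy with rfl | rfl | rfl | rfl | rfl | rfl | rfl
      · rw [h.nu.adj_iff] at hyt; grind only
      · rw [h.nv₀.adj_iff] at hyt; grind only
      · rw [h.nv₁.adj_iff] at hyt; grind only
      · rw [h.nu₀₀.adj_iff] at hyt; grind only
      · rw [h.nu₁₁.adj_iff] at hyt; grind only
      · rw [h.nu₁₀.adj_iff] at hyt; grind only
      · rw [h.nu₀₁.adj_iff] at hyt; grind only
    rcases ht with rfl | rfl | rfl | rfl | rfl | rfl
    · rfl
    · rw [h.nv.adj_iff] at htz; grind only
    · rw [h.nu₀.adj_iff] at htz; grind only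
    · rw [h.nu₁.adj_iff] at htz; grind only
    · rw [h.nv₀₀.adj_iff] at htz; grind only
    · rw [h.nv₁₀.adj_iff] at htz; grind only
  have h3 := hall _ _ _ _ nz.rotate
  rw [hexCount_eq_sum h.nv₁₁.rotate.rotate nt] at h3
  have : t = w := by
    have m1 := key v₁ y h.nv₁₁.adj₁ h.nv₁₁.ne₁₃ nt.adj₂ nt.ne₁₂.symm
    have m2 := key v₁ y' h.nv₁₁.adj₁ h.nv₁₁.ne₁₃ nt.adj₃ nt.ne₁₃.symm
    by_cases c1 : Linked Γ v₁ y
    · exact m1 c1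
    by_cases c2 : Linked Γ v₁ y'
    · exact m2 c2
    rw [if_neg c1, if_neg c2] at h3
    split_ifs at h3 <;> simp at h3
  exact this ▸ nz.adj₃.symm

end Closing

section Labelling

variable {V : Type*} {Γ : SimpleGraph V}

/-- The three neighbours of each of the 16 vertices of a labelled copy of the
Möbius–Kantor graph. -/
def moebiusKantorNbrs : Fin 16 → Fin 3 → Fin 16 :=
  ![![1, 2, 3], ![0, 4, 5], ![0, 6, 7], ![0, 8, 9], ![1, 10, 11], ![1, 12, 13], ![2, 12, 11],
    ![2, 10, 14], ![3, 10, 13], ![3, 12, 14], ![4, 8, 7], ![4, 6, 15], ![5, 6, 9], ![5, 8, 15],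
    ![7, 9, 15], ![11, 13, 14]]

/-- An injective labelling of vertices by `Fin 16` under which neighbourhoods are those
of the Möbius–Kantor graph. -/
structure IsMoebiusKantorLabelling (Γ : SimpleGraph V) (f : Fin 16 → V) : Prop where
  injective : Function.Injective f
  hasNeighbors : ∀ i, HasNeighbors Γ (f i) (f (moebiusKantorNbrs i 0)) (f (moebiusKantorNbrs i 1))
    (f (moebiusKantorNbrs i 2))

lemma HexCore.isMoebiusKantorLabelling (hg : GirthGeSix Γ)
    (hcubic : ∀ v : V, (Γ.neighborSet v).ncard = 3)
    {u v u₀ u₁ v₀ v₁ u₀₀ u₀₁ u₁₀ u₁₁ v₀₀ v₀₁ v₁₀ v₁₁ w z : V}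
    (h : HexCore Γ u v u₀ u₁ v₀ v₁ u₀₀ u₀₁ u₁₀ u₁₁ v₀₀ v₀₁ v₁₀ v₁₁ w w z z)
    (hwz : Γ.Adj w z) :
    IsMoebiusKantorLabelling Γ
      ![u, v, u₀, u₁, v₀, v₁, u₀₀, u₀₁, u₁₀, u₁₁, v₀₀, v₀₁, v₁₀, v₁₁, w, z] := by
  have hball := h.nodup hg
  have hz := h.outer_ne hg
  have hw := h.symm.outer_ne hg
  have hnodup : [w, z, u, v, u₀, u₁, v₀, v₁, u₀₀, u₀₁, u₁₀, u₁₁, v₀₀, v₀₁, v₁₀, v₁₁].Nodup := by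
    refine List.nodup_cons.2 ⟨?_, List.nodup_cons.2 ⟨fun hm => hz z hm rfl, hball⟩⟩
    intro hm
    rcases List.mem_cons.1 hm with rfl | hm
    · exact hwz.ne rfl
    · refine hw w ?_ rfl
      simp only [List.mem_cons, List.not_mem_nil, or_false] at hm ⊢
      tauto
  have hperm : List.Perm [w, z, u, v, u₀, u₁, v₀, v₁, u₀₀, u₀₁, u₁₀, u₁₁, v₀₀, v₀₁, v₁₀, v₁₁]
      (List.ofFn ![u, v, u₀, u₁, v₀, v₁, u₀₀, u₀₁, u₁₀, u₁₁, v₀₀, v₀₁, v₁₀, v₁₁, w, z]) :=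
    List.perm_append_comm (l₁ := [w, z])
  refine ⟨List.nodup_ofFn.1 (hperm.nodup_iff.1 hnodup), ?_⟩
  have n₁ : u₀₁ ≠ u₁₁ := by
    intro h; simp [h] at hball
  have n₂ : v₀₁ ≠ v₁₁ := by
    intro h; simp [h] at hball
  have nw : HasNeighbors Γ w u₀₁ u₁₁ z :=
    hasNeighbors_of_adj hcubic h.nu₀₁.adj₃.symm h.nu₁₁.adj₃.symm hwz n₁
      (fun e => hz u₀₁ (by simp) e.symm) (fun e => hz u₁₁ (by simp) e.symm)
  have nz : HasNeighbors Γ z v₀₁ v₁₁ w :=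
    hasNeighbors_of_adj hcubic h.nv₀₁.adj₃.symm h.nv₁₁.adj₃.symm hwz.symm n₂
      (fun e => hw v₀₁ (by simp) e.symm) (fun e => hw v₁₁ (by simp) e.symm)
  intro i
  fin_cases i
  exacts [h.nu, h.nv, h.nu₀, h.nu₁, h.nv₀, h.nv₁, h.nu₀₀, h.nu₀₁, h.nu₁₀, h.nu₁₁, h.nv₀₀,
    h.nv₀₁, h.nv₁₀, h.nv₁₁, nw, nz]

lemma IsMoebiusKantorLabelling.surjective {f : Fin 16 → V} (h : IsMoebiusKantorLabelling Γ f)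
    (hconn : Γ.Connected) : Function.Surjective f := by
  intro x
  obtain ⟨p⟩ := hconn.preconnected (f 0) x
  have key : ∀ y z : V, Γ.Walk y z → y ∈ Set.range f → z ∈ Set.range f := by
    intro y z p
    induction p with
    | nil => exact id
    | cons hadj _ ih =>
      rintro ⟨i, rfl⟩
      apply ih
      rcases ((h.hasNeighbors i).adj_iff _).1 hadj with rfl | rfl | rfl <;> exact ⟨_, rfl⟩
  exact key _ _ p ⟨0, rfl⟩

lemma IsMoebiusKantorLabelling.nonempty_iso {f : Fin 16 → V} (h : IsMoebiusKantorLabelling Γ f)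
    (hconn : Γ.Connected) {W : Type*} {M : SimpleGraph W} {g : W → Fin 16}
    (hg : Function.Bijective g)
    (hM : ∀ p q, M.Adj p q ↔ ∃ j, g q = moebiusKantorNbrs (g p) j) : Nonempty (Γ ≃g M) := by
  let e : W ≃ V := (Equiv.ofBijective g hg).trans
    (Equiv.ofBijective f ⟨h.injective, h.surjective hconn⟩)
  have he : ∀ p q, Γ.Adj (e p) (e q) ↔ M.Adj p q := by
    intro p q
    change Γ.Adj (f (g p)) (f (g q)) ↔ _
    rw [(h.hasNeighbors _).adj_iff, hM, Fin.exists_fin_succ, Fin.exists_fin_two,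
      h.injective.eq_iff, h.injective.eq_iff, h.injective.eq_iff]
    rfl
  exact ⟨RelIso.symm ⟨e, fun {p q} => he p q⟩⟩

/-- The labels of the vertices of `GP(8, 3)`. -/
def genPetersenLabel : ZMod 8 × Bool → Fin 16 := fun p =>
  bif p.2 then (![3, 4, 12, 8, 11, 9, 10, 6] : Fin 8 → Fin 16) p.1
  else (![0, 1, 5, 13, 15, 14, 7, 2] : Fin 8 → Fin 16) p.1

lemma genPetersenLabel_bijective : Function.Bijective genPetersenLabel := by
  rw [Fintype.bijective_iff_injective_and_card]
  exact ⟨by decide, rfl⟩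

lemma genPetersen_adj_iff (p q : ZMod 8 × Bool) : (genPetersen 8 3).Adj p q ↔
    ∃ j, genPetersenLabel q = moebiusKantorNbrs (genPetersenLabel p) j := by
  rw [genPetersen, SimpleGraph.fromRel_adj]
  revert p q
  decide

/-- The labels of the vertices of `Ψ_8`. -/
def psiLabel : DihedralGroup 8 → Fin 16
  | .r i => (![0, 5, 8, 4, 15, 7, 6, 9] : Fin 8 → Fin 16) i
  | .sr i => (![1, 13, 10, 11, 14, 2, 12, 3] : Fin 8 → Fin 16) i

lemma psiLabel_bijective : Function.Bijective psiLabel := by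
  rw [Fintype.bijective_iff_injective_and_card]
  exact ⟨by decide, rfl⟩

lemma psiGraph_adj_iff (p q : DihedralGroup 8) : (psiGraph 8).Adj p q ↔
    ∃ j, psiLabel q = moebiusKantorNbrs (psiLabel p) j := by
  rw [psiGraph, cayley, SimpleGraph.fromRel_adj]
  simp only [Set.mem_insert_iff, Set.mem_singleton_iff]
  revert p q
  decide

end Labelling

section Signature

variable {V : Type*} {Γ : SimpleGraph V}

lemma HasNeighbors.eq_perm {v x y z p q r : V} (h : HasNeighbors Γ v x y z)
    (h' : HasNeighbors Γ v p q r) :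
    (p = x ∧ q = y ∧ r = z) ∨ (p = x ∧ q = z ∧ r = y) ∨ (p = y ∧ q = x ∧ r = z) ∨
      (p = y ∧ q = z ∧ r = x) ∨ (p = z ∧ q = x ∧ r = y) ∨ (p = z ∧ q = y ∧ r = x) := by
  have h₁ := (h.adj_iff p).1 h'.adj₁
  have h₂ := (h.adj_iff q).1 h'.adj₂
  have h₃ := (h.adj_iff r).1 h'.adj₃
  have := h'.ne₁₂
  have := h'.ne₁₃
  have := h'.ne₂₃
  grind only

/-- The numbers of hexagons through the paths with midpoint `v`, in terms of the signature. -/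
lemma HasNeighbors.hexCount_of_sixCycleCount [Finite V] (hg : GirthGeSix Γ)
    (hcubic : ∀ v : V, (Γ.neighborSet v).ncard = 3) {v x y z : V} {a b c : ℕ}
    (h : HasNeighbors Γ v x y z) (ha : sixCycleCount Γ s(v, x) = a)
    (hb : sixCycleCount Γ s(v, y) = b) (hc : sixCycleCount Γ s(v, z) = c) :
    hexCount Γ x v y + hexCount Γ x v z = a ∧ hexCount Γ x v y + hexCount Γ y v z = b ∧
      hexCount Γ x v z + hexCount Γ y v z = c ∧ hexCount Γ y v z ≤ 4 := by
  have e₁ := sixCycleCount_eq_add hg h.rotate.rotate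
  have e₂ := sixCycleCount_eq_add hg h
  have e₃ := sixCycleCount_eq_add hg h.rotate
  rw [hexCount_comm z v x, hexCount_comm y v x] at e₁
  rw [hexCount_comm z v y] at e₂
  obtain ⟨_, _, ny⟩ := exists_hasNeighbors_of_adj hcubic h.adj₂.symm
  obtain ⟨_, _, nz⟩ := exists_hasNeighbors_of_adj hcubic h.adj₃.symm
  have := hexCount_le_four ny nz
  omega

/-- The first two entries of the signature are equal if the third one is 6. -/
lemma eq_of_hasSignature_six [Finite V] [Nonempty V] (hg : GirthGeSix Γ)
    (hcubic : ∀ v : V, (Γ.neighborSet v).ncard = 3) {a b : ℕ} (hab : a ≤ b) (hb : b ≤ 6)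
    (hsig : hasSignature Γ a b 6) : a = b := by
  by_contra hne
  have hq : ∀ m p q r, HasNeighbors Γ m p q r →
      ¬ (3 ≤ hexCount Γ p m q ∧ 3 ≤ hexCount Γ p m r) := by
    intro m p q r hm
    obtain ⟨x, y, z, nm, hx, hy, hz⟩ := exists_hasNeighbors_of_hasSignature hsig m
    have := nm.hexCount_of_sixCycleCount hg hcubic hx hy hz
    have := hexCount_comm (Γ := Γ) p m q
    have := hexCount_comm (Γ := Γ) p m r
    rcases nm.eq_perm hm with ⟨rfl, rfl, rfl⟩ | ⟨rfl, rfl, rfl⟩ | ⟨rfl, rfl, rfl⟩ |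
      ⟨rfl, rfl, rfl⟩ | ⟨rfl, rfl, rfl⟩ | ⟨rfl, rfl, rfl⟩ <;> omega
  obtain ⟨v⟩ := ‹Nonempty V›
  obtain ⟨x, y, z, nv, hx, hy, hz⟩ := exists_hasNeighbors_of_hasSignature hsig v
  have hv := nv.hexCount_of_sixCycleCount hg hcubic hx hy hz
  obtain ⟨x', y', z', nz, hx', hy', hz'⟩ := exists_hasNeighbors_of_hasSignature hsig z
  have hz₄ := nz.hexCount_of_sixCycleCount hg hcubic hx' hy' hz'
  have h₄ : hexCount Γ y v z = 4 := by omega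
  have h₄' : hexCount Γ y' z z' = 4 := by omega
  rcases (nz.adj_iff v).1 nv.adj₃.symm with rfl | rfl | rfl
  · rw [Sym2.eq_swap, hz] at hx'
    omega
  · exact false_of_hexCount_four_two hg hcubic nv.rotate.rotate.swap
      nz.rotate h₄ (hexCount_comm _ _ _ ▸ h₄') hq
  · exact false_of_hexCount_four_two hg hcubic nv.rotate.rotate.swap
      nz.rotate.rotate.swap h₄ h₄' hq

/-- In a graph of signature `(a, a, 6)`, every edge on six hexagons is the centre of
a `HexCore`. -/
lemma exists_hexCore_of_hasSignature [Finite V] (hg : GirthGeSix Γ)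
    (hcubic : ∀ v : V, (Γ.neighborSet v).ncard = 3) {a : ℕ} (ha : a ≤ 6)
    (hsig : hasSignature Γ a a 6) {v x y z : V} (nv : HasNeighbors Γ v x y z)
    (hx : sixCycleCount Γ s(v, x) = a) (hy : sixCycleCount Γ s(v, y) = a)
    (hz : sixCycleCount Γ s(v, z) = 6) :
    ∃ v₀ v₁ u₀₀ u₀₁ u₁₀ u₁₁ v₀₀ v₀₁ v₁₀ v₁₁ w₀ w₁ z₀ z₁,
      HexCore Γ v z x y v₀ v₁ u₀₀ u₀₁ u₁₀ u₁₁ v₀₀ v₀₁ v₁₀ v₁₁ w₀ w₁ z₀ z₁ := by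
  have hle : ∀ m p q r, HasNeighbors Γ m p q r → hexCount Γ p m q ≤ 3 := by
    intro m p q r hm
    obtain ⟨x, y, z, nm, hx, hy, hz⟩ := exists_hasNeighbors_of_hasSignature hsig m
    have := nm.hexCount_of_sixCycleCount hg hcubic hx hy hz
    have := hexCount_comm (Γ := Γ) p m q
    have := hexCount_comm (Γ := Γ) p m r
    rcases nm.eq_perm hm with ⟨rfl, rfl, rfl⟩ | ⟨rfl, rfl, rfl⟩ | ⟨rfl, rfl, rfl⟩ |
      ⟨rfl, rfl, rfl⟩ | ⟨rfl, rfl, rfl⟩ | ⟨rfl, rfl, rfl⟩ <;> omega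
  have hv := nv.hexCount_of_sixCycleCount hg hcubic hx hy hz
  obtain ⟨p, q, nz⟩ := exists_hasNeighbors_of_adj hcubic nv.adj₃.symm
  have e := sixCycleCount_eq_add hg nz.rotate.rotate
  rw [Sym2.eq_swap, hz, hexCount_comm] at e
  have := hle _ _ _ _ nz
  have := hle _ _ _ _ nz.swap
  rw [hexCount_comm] at this
  refine exists_hexCore hg hcubic hle nv.rotate.rotate nz ?_ ?_ ?_ ?_ <;>
    simp only [hexCount_comm p z v, hexCount_comm q z v] at * <;> omega

/-- A signature `(a, a, 6)` is impossible for `a < 6`. -/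
lemma eq_six_of_hasSignature [Finite V] [Nonempty V] (hg : GirthGeSix Γ)
    (hcubic : ∀ v : V, (Γ.neighborSet v).ncard = 3) {a : ℕ} (ha : a ≤ 6)
    (hsig : hasSignature Γ a a 6) : a = 6 := by
  by_contra hne
  obtain ⟨v⟩ := ‹Nonempty V›
  obtain ⟨x, y, z, nv, hx, hy, hz⟩ := exists_hasNeighbors_of_hasSignature hsig v
  have hv := nv.hexCount_of_sixCycleCount hg hcubic hx hy hz
  obtain ⟨v₀, v₁, u₀₀, u₀₁, u₁₀, u₁₁, v₀₀, v₀₁, v₁₀, v₁₁, w₀, w₁, z₀, z₁, h⟩ :=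
    exists_hexCore_of_hasSignature hg hcubic ha hsig nv hx hy hz
  obtain ⟨hlt, hge⟩ := h.hexCount_lt hg (by omega)
  obtain ⟨x', y', z', nx, hx', hy', hz'⟩ := exists_hasNeighbors_of_hasSignature hsig x
  have hx₄ := nx.hexCount_of_sixCycleCount hg hcubic hx' hy' hz'
  have hvz : v ≠ z' := by
    rintro rfl
    rw [Sym2.eq_swap, hx] at hz'
    exact hne hz'
  rcases nx.eq_perm h.nu₀ with ⟨rfl, rfl, rfl⟩ | ⟨rfl, rfl, rfl⟩ | ⟨rfl, rfl, rfl⟩ |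
      ⟨rfl, rfl, rfl⟩ | ⟨rfl, rfl, rfl⟩ | ⟨rfl, rfl, rfl⟩
  · omega
  · omega
  · rw [hexCount_comm] at hge; omega
  · omega
  · exact hvz rfl
  · exact hvz rfl

/-- A graph of signature `(6, 6, 6)` has a labelling by the vertices of the Möbius–Kantor graph. -/
lemma exists_isMoebiusKantorLabelling [Finite V] [Nonempty V] (hg : GirthGeSix Γ)
    (hcubic : ∀ v : V, (Γ.neighborSet v).ncard = 3) (hsig : hasSignature Γ 6 6 6) :
    ∃ f, IsMoebiusKantorLabelling Γ f := by
  have hall : ∀ m p q r, HasNeighbors Γ m p q r → hexCount Γ p m q = 3 := by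
    intro m p q r hm
    obtain ⟨x, y, z, nm, hx, hy, hz⟩ := exists_hasNeighbors_of_hasSignature hsig m
    have := nm.hexCount_of_sixCycleCount hg hcubic hx hy hz
    have := hexCount_comm (Γ := Γ) p m q
    have := hexCount_comm (Γ := Γ) p m r
    rcases nm.eq_perm hm with ⟨rfl, rfl, rfl⟩ | ⟨rfl, rfl, rfl⟩ | ⟨rfl, rfl, rfl⟩ |
      ⟨rfl, rfl, rfl⟩ | ⟨rfl, rfl, rfl⟩ | ⟨rfl, rfl, rfl⟩ <;> omega
  obtain ⟨v⟩ := ‹Nonempty V›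
  obtain ⟨x, y, z, nv, hx, hy, hz⟩ := exists_hasNeighbors_of_hasSignature hsig v
  obtain ⟨v₀, v₁, u₀₀, u₀₁, u₁₀, u₁₁, v₀₀, v₀₁, v₁₀, v₁₁, w₀, w₁, z₀, z₁, h⟩ :=
    exists_hexCore_of_hasSignature hg hcubic le_rfl hsig nv hx hy hz
  obtain rfl := h.eq_of_hexCount hg (hall _ _ _ _ h.nu.rotate)
  obtain rfl := h.symm.eq_of_hexCount hg (hall _ _ _ _ h.nv.rotate)
  exact ⟨_, h.isMoebiusKantorLabelling hg hcubic (h.adj_outer hg hcubic hall)⟩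

end Signature

/-- A finite connected simple cubic vertex-transitive graph of girth 6
with signature `(a, b, 6)` has `a = b = 6` and is the Möbius–Kantor graph
`GP(8, 3)`, equivalently `Ψ_8`. -/
theorem cubic_vt_girth_six_signature_c_eq_six {V : Type*} [Fintype V] (Γ : SimpleGraph V)
    (hconn : Γ.Connected)
    (hcubic : ∀ v : V, (Γ.neighborSet v).ncard = 3)
    (hvt : ∀ u v : V, ∃ φ : Γ ≃g Γ, φ u = v)
    (hgirth : Γ.girth = 6)
    (a b : ℕ) (hab : a ≤ b) (hb : b ≤ 6)
    (hsig : hasSignature Γ a b 6) :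
    a = 6 ∧ b = 6 ∧ Nonempty (Γ ≃g genPetersen 8 3) ∧ Nonempty (Γ ≃g psiGraph 8) := by
  have hg := girthGeSix_of_girth_eq hgirth
  have := hconn.nonempty
  obtain rfl := eq_of_hasSignature_six hg hcubic hab hb hsig
  obtain rfl := eq_six_of_hasSignature hg hcubic hb hsig
  obtain ⟨f, hf⟩ := exists_isMoebiusKantorLabelling hg hcubic hsig
  exact ⟨rfl, rfl, hf.nonempty_iso hconn genPetersenLabel_bijective genPetersen_adj_iff,
    hf.nonempty_iso hconn psiLabel_bijective psiGraph_adj_iff⟩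
end

section
/- Let Γ be a finite connected simple cubic vertex-transitive graph of girth 6 with signature (a, b, c) where b < c = 5. Then a = 3, b = 4, and Γ is isomorphic to Ψ_n = Cay(D_n, {τ_0, τ_1, τ_3}) for some integer n ≥ 10. -/
open SimpleGraph
structure SimpleGraph.IsHexagon {V : Type*} (G : SimpleGraph V) (x₀ x₁ x₂ x₃ x₄ x₅ : V) : Prop where
  adj₀ : G.Adj x₀ x₁
  adj₁ : G.Adj x₁ x₂
  adj₂ : G.Adj x₂ x₃
  adj₃ : G.Adj x₃ x₄
  adj₄ : G.Adj x₄ x₅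
  adj₅ : G.Adj x₅ x₀
  ne₀ : x₀ ≠ x₂
  ne₁ : x₁ ≠ x₃
  ne₂ : x₂ ≠ x₄
  ne₃ : x₃ ≠ x₅
  ne₄ : x₄ ≠ x₀
  ne₅ : x₅ ≠ x₁

section
variable {V : Type*} {G : SimpleGraph V}

theorem no_triangle (hg : G.girth = 6) {x y z : V} (h₀ : G.Adj x y) (h₁ : G.Adj y z)
    (h₂ : G.Adj z x) : False := by
  have hc : (Walk.cons h₀ (Walk.cons h₁ (Walk.cons h₂ Walk.nil))).IsCycle := by
    simp [Walk.cons_isCycle_iff, h₀.ne, h₀.ne', h₁.ne, h₂.ne, h₂.ne']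
  have := hc.girth_le_length
  simp [hg] at this

theorem no_square (hg : G.girth = 6) {x y z w : V} (h₀ : G.Adj x y) (h₁ : G.Adj y z)
    (h₂ : G.Adj z w) (h₃ : G.Adj w x) (hxz : x ≠ z) (hyw : y ≠ w) : False := by
  have hc : (Walk.cons h₀ (Walk.cons h₁ (Walk.cons h₂ (Walk.cons h₃ Walk.nil)))).IsCycle := by
    simp [Walk.cons_isCycle_iff, h₀.ne, h₀.ne', h₁.ne, h₂.ne, h₃.ne, h₃.ne',
      hxz, hxz.symm, hyw]
  have := hc.girth_le_length
  simp [hg] at this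

theorem SimpleGraph.IsHexagon.rotate {x₀ x₁ x₂ x₃ x₄ x₅ : V}
    (h : G.IsHexagon x₀ x₁ x₂ x₃ x₄ x₅) : G.IsHexagon x₁ x₂ x₃ x₄ x₅ x₀ :=
  ⟨h.adj₁, h.adj₂, h.adj₃, h.adj₄, h.adj₅, h.adj₀, h.ne₁, h.ne₂, h.ne₃, h.ne₄, h.ne₅, h.ne₀⟩

theorem SimpleGraph.IsHexagon.reverse {x₀ x₁ x₂ x₃ x₄ x₅ : V}
    (h : G.IsHexagon x₀ x₁ x₂ x₃ x₄ x₅) : G.IsHexagon x₁ x₀ x₅ x₄ x₃ x₂ :=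
  ⟨h.adj₀.symm, h.adj₅.symm, h.adj₄.symm, h.adj₃.symm, h.adj₂.symm, h.adj₁.symm,
    h.ne₅.symm, h.ne₄.symm, h.ne₃.symm, h.ne₂.symm, h.ne₁.symm, h.ne₀.symm⟩

theorem exists_cycle_edges (hg : G.girth = 6) {x₀ x₁ x₂ x₃ x₄ x₅ : V}
    (h : G.IsHexagon x₀ x₁ x₂ x₃ x₄ x₅) :
    ∃ (v : V) (w : G.Walk v v), w.IsCycle ∧ w.length = 6 ∧
      ({s(x₀, x₁), s(x₁, x₂), s(x₂, x₃), s(x₃, x₄), s(x₄, x₅), s(x₅, x₀)} : Set (Sym2 V)) =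
        {e' | e' ∈ w.edges} := by
  obtain ⟨a0, a1, a2, a3, a4, a5, n0, n1, n2, n3, n4, n5⟩ := h
  have m0 : x₀ ≠ x₃ := by rintro rfl; exact no_triangle hg a0 a1 a2
  have m1 : x₁ ≠ x₄ := by rintro rfl; exact no_triangle hg a1 a2 a3
  have m2 : x₂ ≠ x₅ := by rintro rfl; exact no_triangle hg a2 a3 a4
  refine ⟨x₀, .cons a0 (.cons a1 (.cons a2 (.cons a3 (.cons a4 (.cons a5 .nil))))), ?_, rfl, ?_⟩
  · have := a0.ne; have := a1.ne; have := a2.ne; have := a3.ne; have := a4.ne; have := a5.ne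
    simp [Walk.cons_isCycle_iff]
    grind
  · ext e; simp

theorem exists_hexagon_of_cycle {v p q : V} (w : G.Walk v v) (hw : w.IsCycle) (hl : w.length = 6)
    (he : s(p, q) ∈ w.edges) :
    ∃ x₂ x₃ x₄ x₅, G.IsHexagon p q x₂ x₃ x₄ x₅ ∧
      ({s(p, q), s(q, x₂), s(x₂, x₃), s(x₃, x₄), s(x₄, x₅), s(x₅, p)} : Set (Sym2 V)) =
        {e' | e' ∈ w.edges} := by
  obtain ⟨x₀, x₁, x₂, x₃, x₄, x₅, h, hE⟩ : ∃ x₀ x₁ x₂ x₃ x₄ x₅, G.IsHexagon x₀ x₁ x₂ x₃ x₄ x₅ ∧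
      ({s(x₀, x₁), s(x₁, x₂), s(x₂, x₃), s(x₃, x₄), s(x₄, x₅), s(x₅, x₀)} : Set (Sym2 V)) =
        {e' | e' ∈ w.edges} := by
    match w, hw, hl with
    | .cons (v := x₁) a0 (.cons (v := x₂) a1 (.cons (v := x₃) a2 (.cons (v := x₄) a3
        (.cons (v := x₅) a4 (.cons a5 .nil))))), hw, _ =>
      simp [Walk.cons_isCycle_iff] at hw
      refine ⟨v, x₁, x₂, x₃, x₄, x₅, ⟨a0, a1, a2, a3, a4, a5, ?_, ?_, ?_, ?_, ?_, ?_⟩, ?_⟩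
      iterate 6 grind
      ext e; simp
  have he' : s(p, q) ∈ ({s(x₀, x₁), s(x₁, x₂), s(x₂, x₃), s(x₃, x₄), s(x₄, x₅), s(x₅, x₀)} :
      Set (Sym2 V)) := hE ▸ he
  rw [← hE]
  simp only [Set.mem_insert_iff, Set.mem_singleton_iff, Sym2.eq_iff] at he'
  have h₁ := h.rotate
  have h₂ := h₁.rotate
  have h₃ := h₂.rotate
  have h₄ := h₃.rotate
  have h₅ := h₄.rotate
  rcases he' with (⟨rfl, rfl⟩ | ⟨rfl, rfl⟩) | (⟨rfl, rfl⟩ | ⟨rfl, rfl⟩) | (⟨rfl, rfl⟩ |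
      ⟨rfl, rfl⟩) | (⟨rfl, rfl⟩ | ⟨rfl, rfl⟩) | (⟨rfl, rfl⟩ | ⟨rfl, rfl⟩) | (⟨rfl, rfl⟩ | ⟨rfl, rfl⟩)
  · exact ⟨_, _, _, _, h, rfl⟩
  · exact ⟨_, _, _, _, h.reverse, by ext e; simp [Sym2.eq_swap]; tauto⟩
  · exact ⟨_, _, _, _, h₁, by ext e; simp; tauto⟩
  · exact ⟨_, _, _, _, h₁.reverse, by ext e; simp [Sym2.eq_swap]; tauto⟩
  · exact ⟨_, _, _, _, h₂, by ext e; simp; tauto⟩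
  · exact ⟨_, _, _, _, h₂.reverse, by ext e; simp [Sym2.eq_swap]; tauto⟩
  · exact ⟨_, _, _, _, h₃, by ext e; simp; tauto⟩
  · exact ⟨_, _, _, _, h₃.reverse, by ext e; simp [Sym2.eq_swap]; tauto⟩
  · exact ⟨_, _, _, _, h₄, by ext e; simp; tauto⟩
  · exact ⟨_, _, _, _, h₄.reverse, by ext e; simp [Sym2.eq_swap]; tauto⟩
  · exact ⟨_, _, _, _, h₅, by ext e; simp; tauto⟩
  · exact ⟨_, _, _, _, h₅.reverse, by ext e; simp [Sym2.eq_swap]; tauto⟩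

theorem hexagon_ext (hg : G.girth = 6) {p q x₂ x₃ x₄ x₅ y₂ y₃ y₄ y₅ : V}
    (h : G.IsHexagon p q x₂ x₃ x₄ x₅) (h' : G.IsHexagon p q y₂ y₃ y₄ y₅)
    (he : ({s(p, q), s(q, x₂), s(x₂, x₃), s(x₃, x₄), s(x₄, x₅), s(x₅, p)} : Set (Sym2 V)) =
      {s(p, q), s(q, y₂), s(y₂, y₃), s(y₃, y₄), s(y₄, y₅), s(y₅, p)}) :
    x₂ = y₂ ∧ x₃ = y₃ ∧ x₄ = y₄ ∧ x₅ = y₅ := by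
  obtain ⟨a0, a1, a2, a3, a4, a5, n0, n1, n2, n3, n4, n5⟩ := h
  have m0 : p ≠ x₃ := by rintro rfl; exact no_triangle hg a0 a1 a2
  have m1 : q ≠ x₄ := by rintro rfl; exact no_triangle hg a1 a2 a3
  have m2 : x₂ ≠ x₅ := by rintro rfl; exact no_triangle hg a2 a3 a4
  obtain ⟨b0, b1, b2, b3, b4, b5, k0, k1, k2, k3, k4, k5⟩ := h'
  have l0 : p ≠ y₃ := by rintro rfl; exact no_triangle hg b0 b1 b2
  have l1 : q ≠ y₄ := by rintro rfl; exact no_triangle hg b1 b2 b3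
  have l2 : y₂ ≠ y₅ := by rintro rfl; exact no_triangle hg b2 b3 b4
  replace a0 := a0.ne; replace a1 := a1.ne; replace a2 := a2.ne
  replace a3 := a3.ne; replace a4 := a4.ne; replace a5 := a5.ne
  replace b0 := b0.ne; replace b1 := b1.ne; replace b2 := b2.ne
  replace b3 := b3.ne; replace b4 := b4.ne; replace b5 := b5.ne
  have e2 : s(q, x₂) ∈ ({s(p, q), s(q, y₂), s(y₂, y₃), s(y₃, y₄), s(y₄, y₅), s(y₅, p)} :
      Set (Sym2 V)) := by
    rw [← he]; simp
  have e3 : s(x₂, x₃) ∈ ({s(p, q), s(q, y₂), s(y₂, y₃), s(y₃, y₄), s(y₄, y₅), s(y₅, p)} :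
      Set (Sym2 V)) := by
    rw [← he]; simp
  have e4 : s(x₃, x₄) ∈ ({s(p, q), s(q, y₂), s(y₂, y₃), s(y₃, y₄), s(y₄, y₅), s(y₅, p)} :
      Set (Sym2 V)) := by
    rw [← he]; simp
  have e5 : s(x₄, x₅) ∈ ({s(p, q), s(q, y₂), s(y₂, y₃), s(y₃, y₄), s(y₄, y₅), s(y₅, p)} :
      Set (Sym2 V)) := by
    rw [← he]; simp
  clear he
  simp only [Set.mem_insert_iff, Set.mem_singleton_iff, Sym2.eq_iff] at e2 e3 e4 e5
  have r2 : x₂ = y₂ := by clear e3 e4 e5; grind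
  subst r2
  have r3 : x₃ = y₃ := by clear e2 e4 e5; grind
  subst r3
  have r4 : x₄ = y₄ := by clear e2 e3 e5; grind
  subst r4
  have r5 : x₅ = y₅ := by clear e2 e3 e4; grind
  exact ⟨rfl, rfl, rfl, r5⟩

theorem sixCycleCount_eq (hg : G.girth = 6) (p q : V) :
    sixCycleCount G s(p, q) =
      {t : V × V × V × V | G.IsHexagon p q t.1 t.2.1 t.2.2.1 t.2.2.2}.ncard := by
  symm
  refine Set.ncard_congr (fun t _ => ({s(p, q), s(q, t.1), s(t.1, t.2.1), s(t.2.1, t.2.2.1),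
    s(t.2.2.1, t.2.2.2), s(t.2.2.2, p)} : Set (Sym2 V))) ?_ ?_ ?_
  · intro t ht
    exact ⟨exists_cycle_edges hg ht, by simp⟩
  · rintro ⟨x₂, x₃, x₄, x₅⟩ ⟨y₂, y₃, y₄, y₅⟩ hx hy he
    obtain ⟨rfl, rfl, rfl, rfl⟩ := hexagon_ext hg hx hy he
    rfl
  · rintro s ⟨⟨v, w, hw, hl, rfl⟩, hs⟩
    obtain ⟨x₂, x₃, x₄, x₅, h, he⟩ := exists_hexagon_of_cycle w hw hl hs
    exact ⟨(x₂, x₃, x₄, x₅), h, he⟩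

theorem isHexagon_map_iff (φ : G ≃g G) {x₀ x₁ x₂ x₃ x₄ x₅ : V} :
    G.IsHexagon (φ x₀) (φ x₁) (φ x₂) (φ x₃) (φ x₄) (φ x₅) ↔ G.IsHexagon x₀ x₁ x₂ x₃ x₄ x₅ := by
  constructor <;> rintro ⟨a0, a1, a2, a3, a4, a5, n0, n1, n2, n3, n4, n5⟩ <;> constructor <;>
    simp only [φ.map_adj_iff, φ.injective.ne_iff] at * <;> assumption

theorem sixCycleCount_map (hg : G.girth = 6) (φ : G ≃g G) (p q : V) :
    sixCycleCount G s(φ p, φ q) = sixCycleCount G s(p, q) := by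
  rw [sixCycleCount_eq hg, sixCycleCount_eq hg]
  symm
  refine Set.ncard_congr (fun t _ => (φ t.1, φ t.2.1, φ t.2.2.1, φ t.2.2.2)) ?_ ?_ ?_
  · intro t ht
    exact (isHexagon_map_iff φ).2 ht
  · rintro ⟨x₂, x₃, x₄, x₅⟩ ⟨y₂, y₃, y₄, y₅⟩ - - he
    simpa using he
  · rintro ⟨x₂, x₃, x₄, x₅⟩ h
    refine ⟨(φ.symm x₂, φ.symm x₃, φ.symm x₄, φ.symm x₅), ?_, by simp⟩
    rw [Set.mem_ofPred_eq, ← isHexagon_map_iff φ]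
    simpa using h

theorem even_ncard_hexagons [Finite V] (u : V) :
    Even {t : V × V × V × V × V |
      G.IsHexagon u t.1 t.2.1 t.2.2.1 t.2.2.2.1 t.2.2.2.2}.ncard := by
  classical
  have := Fintype.ofFinite V
  rw [Set.ncard_eq_toFinset_card', ← ZMod.natCast_eq_zero_iff_even, Finset.card_eq_sum_ones,
    Nat.cast_sum]
  refine Finset.sum_involution
    (fun t _ => (t.2.2.2.2, t.2.2.2.1, t.2.2.1, t.2.1, t.1)) ?_ ?_ ?_ ?_
  · intro t _
    decide
  · intro t ht _ he
    have ht' : G.IsHexagon u t.1 t.2.1 t.2.2.1 t.2.2.2.1 t.2.2.2.2 := by simpa using ht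
    exact ht'.ne₅ (congrArg Prod.fst he)
  · intro t ht
    have ht' : G.IsHexagon u t.1 t.2.1 t.2.2.1 t.2.2.2.1 t.2.2.2.2 := by simpa using ht
    simpa using ht'.reverse.rotate
  · intro t _
    rfl

theorem even_sum_sixCycleCount [Finite V] (hg : G.girth = 6) {u p q r : V} (hpq : p ≠ q)
    (hpr : p ≠ r) (hqr : q ≠ r) (hn : ∀ w, G.Adj u w → w = p ∨ w = q ∨ w = r) :
    Even (sixCycleCount G s(u, p) + sixCycleCount G s(u, q) + sixCycleCount G s(u, r)) := by
  classical
  have := Fintype.ofFinite V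
  have h := even_ncard_hexagons (G := G) u
  rw [Set.ncard_eq_toFinset_card', Finset.card_eq_sum_card_fiberwise (f := Prod.fst)
    (t := {p, q, r})] at h
  · have key : ∀ w, sixCycleCount G s(u, w) = ({t ∈ {t : V × V × V × V × V |
      G.IsHexagon u t.1 t.2.1 t.2.2.1 t.2.2.2.1 t.2.2.2.2}.toFinset | t.1 = w}).card := by
      intro w
      rw [sixCycleCount_eq hg, ← Set.ncard_coe_finset]
      refine Set.ncard_congr (fun t _ => (w, t)) ?_ ?_ ?_
      · intro t ht
        simpa using ht
      · intro s t _ _ h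
        simpa using h
      · rintro ⟨x, t⟩ ht
        simp at ht
        obtain ⟨ht, rfl⟩ := ht
        exact ⟨t, ht, rfl⟩
    rw [Finset.sum_insert (by simp [hpq, hpr]), Finset.sum_insert (by simp [hqr]),
      Finset.sum_singleton, ← key, ← key, ← key, ← add_assoc] at h
    exact h
  · intro t ht
    simp at ht ⊢
    exact hn _ ht.adj₀
end

/-- Words of length six over three letters, read cyclically. -/
abbrev HexWord := Fin 6 → Fin 3

namespace HexWord

/-- Cyclically consecutive letters of the word are distinct. -/
abbrev Proper (w : HexWord) : Prop := ∀ i, w i ≠ w (i + 1)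

/-- The dihedral action on cyclic words. -/
def move (s : Bool) (k : Fin 6) (w : HexWord) : HexWord :=
  fun i => if s then w (k - i) else w (k + i)

/-- Representatives of the proper words up to rotation and reversal. -/
def rep : Fin 13 → HexWord :=
  ![![0, 1, 0, 1, 0, 1], ![0, 1, 0, 1, 0, 2], ![0, 1, 0, 1, 2, 1], ![0, 1, 0, 2, 0, 2],
    ![0, 1, 0, 2, 1, 2], ![0, 1, 2, 0, 1, 2], ![0, 1, 2, 0, 2, 1], ![0, 1, 2, 1, 0, 2],
    ![0, 1, 2, 1, 2, 1], ![0, 2, 0, 2, 0, 2], ![0, 2, 0, 2, 1, 2], ![0, 2, 1, 2, 1, 2],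
    ![1, 2, 1, 2, 1, 2]]

/-- The dihedral orbit of the `i`-th representative, restricted to words starting with `c`. -/
def orbitFrom (c : Fin 3) (i : Fin 13) : Finset HexWord :=
  (Finset.univ.image fun p : Bool × Fin 6 => move p.1 p.2 (rep i)).filter (· 0 = c)

theorem exists_move_rep (w : HexWord) (hw : w.Proper) : ∃ i s k, w = move s k (rep i) := by
  revert w; decide +kernel

theorem proper_move_rep : ∀ i s k, (move s k (rep i)).Proper := by
  decide +kernel

theorem disjoint_orbitFrom : ∀ c i j, i ≠ j → Disjoint (orbitFrom c i) (orbitFrom c j) := by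
  decide +kernel

/-- The number of words starting with `c` in the orbit of the `i`-th representative. -/
def startCount : Fin 3 → Fin 13 → ℕ :=
  ![![1, 3, 2, 3, 2, 2, 2, 2, 1, 1, 2, 1, 0], ![1, 2, 3, 1, 2, 2, 2, 2, 3, 0, 1, 2, 1],
    ![0, 1, 1, 2, 2, 2, 2, 2, 2, 1, 3, 3, 1]]

theorem card_orbitFrom : ∀ c i, (orbitFrom c i).card = startCount c i := by
  decide +kernel

/-- The `i`-th and `j`-th orbits contain distinct words sharing their first four letters. -/
def Overlap (i j : Fin 13) : Prop :=
  ∃ s k s' k', move s k (rep i) ≠ move s' k' (rep j) ∧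
    ∀ l < 4, move s k (rep i) l = move s' k' (rep j) l

instance : DecidableRel Overlap := fun _ _ => inferInstanceAs (Decidable (∃ _, _))

/-- Pairs of overlapping orbits. -/
def overlaps : List (Fin 13 × Fin 13) :=
  [(0, 1), (0, 2), (1, 2), (1, 3), (1, 4), (1, 7), (2, 6), (2, 7), (2, 8), (3, 4), (3, 7), (3, 9),
    (3, 10), (4, 5), (4, 10), (4, 11), (5, 6), (5, 7), (6, 8), (6, 10), (6, 11), (7, 8), (8, 11),
    (8, 12), (9, 10), (10, 11), (11, 12)]

theorem overlap_of_mem : ∀ p ∈ overlaps, Overlap p.1 p.2 := by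
  decide +kernel

/-- Two relators from the `i`-th orbit with a common prefix of length three have a quotient in
the fifth orbit. -/
def Glues (i : Fin 13) : Prop :=
  ∃ s k s' k' s'' k'', (∀ l < 3, move s k (rep i) l = move s' k' (rep i) l) ∧
    ![move s k (rep i) 3, move s k (rep i) 4, move s k (rep i) 5, move s' k' (rep i) 5,
      move s' k' (rep i) 4, move s' k' (rep i) 3] = move s'' k'' (rep 5)

instance : DecidablePred Glues := fun _ => inferInstanceAs (Decidable (∃ _, _))

/-- The total number of words starting with `c` in the orbits selected by `p`. -/
def selectedCount (p : Fin 13 → Bool) (c : Fin 3) : ℕ :=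
  ∑ i, if p i then startCount c i else 0

/-- The constraints on the set of orbits of relators. -/
def admissible (p : Fin 13 → Bool) : Bool :=
  (overlaps.all fun q => !(p q.1 && p q.2)) && (!p 8 || p 5) && (!p 11 || p 5) &&
    (selectedCount p 2 == 5) && Nat.blt (selectedCount p 0) (selectedCount p 1) &&
    Nat.blt (selectedCount p 1) 5

theorem eq_of_admissible : ∀ p, admissible p → ∀ i, p i = (i == 5 || i == 11) := by
  simp only [Fin.forall_fin_succ_pi, Fin.forall_fin_zero_pi]
  decide +kernel

variable {Rel : HexWord → Prop}

theorem rel_move_iff (hrot : ∀ w, Rel w ↔ Rel fun i => w (i + 1))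
    (hrev : ∀ w, Rel w ↔ Rel fun i => w (-i)) (s : Bool) (k : Fin 6) (w : HexWord) :
    Rel (move s k w) ↔ Rel w := by
  have hk : ∀ (k : ℕ) (w : HexWord), Rel w ↔ Rel fun i => w (Fin.ofNat 6 k + i) := by
    intro k
    induction k with
    | zero => intro w; simp
    | succ k ih =>
      intro w
      rw [hrot, ih]
      have : ∀ i, Fin.ofNat 6 k + i + 1 = Fin.ofNat 6 (k + 1) + i := by
        intro i; ext; simp [Fin.val_add]; omega
      simp only [this]
  have hk' : ∀ (k : Fin 6) (w : HexWord), Rel w ↔ Rel fun i => w (k + i) := by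
    intro k w
    simpa using hk k w
  cases s
  · exact (hk' k w).symm
  · rw [hk' k w, hrev]
    simp [move, sub_eq_add_neg]

open Classical in
theorem card_filter_rel (hrot : ∀ w, Rel w ↔ Rel fun i => w (i + 1))
    (hrev : ∀ w, Rel w ↔ Rel fun i => w (-i)) (c : Fin 3) :
    (Finset.univ.filter fun w : HexWord => w.Proper ∧ w 0 = c ∧ Rel w).card =
      ∑ i, if Rel (rep i) then (orbitFrom c i).card else 0 := by
  have : (Finset.univ.filter fun w : HexWord => w.Proper ∧ w 0 = c ∧ Rel w) =
      (Finset.univ.filter fun i => Rel (rep i)).biUnion (orbitFrom c) := by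
    ext w
    simp only [Finset.mem_filter, Finset.mem_univ, true_and, Finset.mem_biUnion, orbitFrom,
      Finset.mem_image, Prod.exists]
    constructor
    · rintro ⟨hp, hc, hr⟩
      obtain ⟨i, s, k, rfl⟩ := exists_move_rep w hp
      exact ⟨i, (rel_move_iff hrot hrev s k _).1 hr, ⟨s, k, rfl⟩, hc⟩
    · rintro ⟨i, hr, ⟨s, k, rfl⟩, hc⟩
      exact ⟨proper_move_rep i s k, hc, (rel_move_iff hrot hrev s k _).2 hr⟩
  rw [this, Finset.card_biUnion fun i _ j _ h => disjoint_orbitFrom c i j h, Finset.sum_filter]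

open Classical in
theorem rel_classification (hrot : ∀ w, Rel w ↔ Rel fun i => w (i + 1))
    (hrev : ∀ w, Rel w ↔ Rel fun i => w (-i))
    (hpre : ∀ w w', Proper w → Proper w' → Rel w → Rel w' → (∀ l < 4, w l = w' l) → w = w')
    (hglue : ∀ w w', Rel w → Rel w' → (∀ l < 3, w l = w' l) →
      Rel ![w 3, w 4, w 5, w' 5, w' 4, w' 3])
    {a b : ℕ} (hab : a < b) (hb : b < 5)
    (hcard : ∀ c, (Finset.univ.filter fun w : HexWord => w.Proper ∧ w 0 = c ∧ Rel w).card =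
      (![a, b, 5] : Fin 3 → ℕ) c) :
    a = 3 ∧ b = 4 ∧ ∀ i, Rel (rep i) ↔ i = 5 ∨ i = 11 := by
  have hmove := rel_move_iff hrot hrev
  have hexcl : ∀ i j, Overlap i j → ¬(Rel (rep i) ∧ Rel (rep j)) := by
    rintro i j ⟨s, k, s', k', hne, hl⟩ ⟨hi, hj⟩
    exact hne (hpre _ _ (proper_move_rep _ _ _) (proper_move_rep _ _ _) ((hmove _ _ _).2 hi)
      ((hmove _ _ _).2 hj) hl)
  have hderiv : ∀ i, Glues i → Rel (rep i) → Rel (rep 5) := by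
    rintro i ⟨s, k, s', k', s'', k'', hl, he⟩ hi
    have := hglue _ _ ((hmove s k _).2 hi) ((hmove s' k' _).2 hi) hl
    rw [he] at this
    exact (hmove _ _ _).1 this
  have hsum : ∀ c, selectedCount (fun i => decide (Rel (rep i))) c =
      (![a, b, 5] : Fin 3 → ℕ) c := by
    intro c
    rw [← hcard, card_filter_rel hrot hrev]
    simp [selectedCount, card_orbitFrom]
  have hS := eq_of_admissible (fun i => decide (Rel (rep i))) (by
    have h8 := hderiv 8 (by decide +kernel)
    have h11 := hderiv 11 (by decide +kernel)
    simp only [admissible, hsum, Bool.and_eq_true, List.all_eq_true]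
    refine ⟨⟨⟨⟨⟨fun p hp => ?_, ?_⟩, ?_⟩, rfl⟩, ?_⟩, ?_⟩
    · simpa [imp_iff_not_or] using hexcl _ _ (overlap_of_mem p hp)
    · simpa [← imp_iff_not_or] using h8
    · simpa [← imp_iff_not_or] using h11
    · simpa using hab
    · simpa using hb)
  have h0 := hsum 0
  have h1 := hsum 1
  simp only [selectedCount, hS] at h0 h1
  refine ⟨h0.symm, h1.symm, fun i => ?_⟩
  have := hS i
  rw [Bool.eq_iff_iff] at this
  simpa using this
end HexWord

open Equiv

/-- The neighbours of each vertex are the images under three fixed-point-free involutions which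
generate a semiregular permutation group. -/
structure SimpleGraph.IsInvolutiveColouring {V : Type*} (G : SimpleGraph V)
    (P : Fin 3 → Perm V) : Prop where
  adj_iff : ∀ v w, G.Adj v w ↔ ∃ i, w = P i v
  mul_self : ∀ i, P i * P i = 1
  inj : ∀ i j v, P i v = P j v → i = j
  free : ∀ g ∈ Subgroup.closure (Set.range P), ∀ v, g v = v → g = 1

section
variable {V : Type*} {G : SimpleGraph V}

theorem exists_involutions {m : Fin 3 → ℕ} (hm : m.Injective)
    (h : ∀ v, ∃ f : Fin 3 → V, (∀ i, G.Adj v (f i) ∧ sixCycleCount G s(v, f i) = m i) ∧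
      ∀ w, G.Adj v w → ∃ i, w = f i)
    (hg : G.girth = 6) (hvt : ∀ u v : V, ∃ φ : G ≃g G, φ u = v) :
    ∃ P : Fin 3 → Perm V, G.IsInvolutiveColouring P ∧
      ∀ v i, sixCycleCount G s(v, P i v) = m i := by
  choose f hf hfn using h
  have huniq : ∀ v w i, G.Adj v w → sixCycleCount G s(v, w) = m i → w = f v i := by
    intro v w i hw hc
    obtain ⟨j, rfl⟩ := hfn v w hw
    rw [(hf v j).2] at hc
    rw [hm hc]
  have hinv : ∀ i, Function.Involutive fun v => f v i := fun i v =>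
    (huniq _ _ _ (hf v i).1.symm (by rw [Sym2.eq_swap]; exact (hf v i).2)).symm
  have hφ : ∀ (φ : G ≃g G) v i, φ (f v i) = f (φ v) i := fun φ v i =>
    huniq _ _ _ (φ.map_adj_iff.2 (hf v i).1) (by rw [sixCycleCount_map hg]; exact (hf v i).2)
  refine ⟨fun i => (hinv i).toPerm, ⟨?_, ?_, ?_, ?_⟩, fun v i => (hf v i).2⟩
  · exact fun v w => ⟨hfn v w, fun ⟨i, hi⟩ => hi ▸ (hf v i).1⟩
  · exact fun i => Equiv.ext (hinv i)
  · intro i j v hij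
    apply hm
    rw [← (hf v i).2, ← (hf v j).2]
    exact congrArg (fun w => sixCycleCount G s(v, w)) hij
  · have hcomm : ∀ g ∈ Subgroup.closure (Set.range fun i => (hinv i).toPerm),
        ∀ (φ : G ≃g G) v, φ (g v) = g (φ v) := by
      intro g hg
      induction hg using Subgroup.closure_induction with
      | mem g hg =>
        obtain ⟨i, rfl⟩ := hg
        exact fun φ v => hφ φ v i
      | one => simp
      | mul g h _ _ ihg ihh => simp [ihg, ihh]
      | inv g _ ih =>
        intro φ v
        rw [Perm.eq_inv_iff_eq, ← ih]
        simp
    intro g hg v hv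
    ext w
    obtain ⟨φ, rfl⟩ := hvt v w
    rw [← hcomm g hg, hv]
    rfl

theorem exists_involutions_of_hasSignature [Finite V] [Nonempty V] (hg : G.girth = 6)
    (hvt : ∀ u v : V, ∃ φ : G ≃g G, φ u = v) {a b : ℕ} (hab : a ≤ b) (hb : b < 5)
    (hsig : hasSignature G a b 5) :
    a < b ∧ ∃ P : Fin 3 → Perm V, G.IsInvolutiveColouring P ∧
      ∀ v i, sixCycleCount G s(v, P i v) = (![a, b, 5] : Fin 3 → ℕ) i := by
  have h : ∀ v, ∃ f : Fin 3 → V, (∀ i, G.Adj v (f i) ∧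
      sixCycleCount G s(v, f i) = (![a, b, 5] : Fin 3 → ℕ) i) ∧
      (∀ w, G.Adj v w → ∃ i, w = f i) ∧ f.Injective := by
    intro v
    obtain ⟨e₁, e₂, e₃, h₁₂, h₁₃, h₂₃, hinc, c₁, c₂, c₃⟩ := hsig v
    have hex : ∀ e ∈ ({e₁, e₂, e₃} : Set (Sym2 V)), ∃ w, G.Adj v w ∧ e = s(v, w) := by
      intro e he
      rw [← hinc] at he
      obtain ⟨w, rfl⟩ := Sym2.mem_iff_exists.1 he.2
      exact ⟨w, he.1, rfl⟩
    obtain ⟨p, hp, rfl⟩ := hex e₁ (by simp)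
    obtain ⟨q, hq, rfl⟩ := hex e₂ (by simp)
    obtain ⟨r, hr, rfl⟩ := hex e₃ (by simp)
    refine ⟨![p, q, r], ?_, ?_, ?_⟩
    · simp [Fin.forall_fin_succ, *]
    · intro w hw
      have : s(v, w) ∈ G.incidenceSet v := ⟨hw, by simp⟩
      rw [hinc] at this
      simpa [Fin.exists_fin_succ, hw.ne'] using this
    · have hpq : p ≠ q := by rintro rfl; exact h₁₂ rfl
      have hpr : p ≠ r := by rintro rfl; exact h₁₃ rfl
      have hqr : q ≠ r := by rintro rfl; exact h₂₃ rfl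
      intro i j hij
      fin_cases i <;> fin_cases j <;> simp_all
  have hlt : a < b := by
    obtain ⟨v⟩ := ‹Nonempty V›
    obtain ⟨f, hf, hfn, hinj⟩ := h v
    have hpar := even_sum_sixCycleCount hg (hinj.ne (show (0 : Fin 3) ≠ 1 by decide))
      (hinj.ne (show (0 : Fin 3) ≠ 2 by decide)) (hinj.ne (show (1 : Fin 3) ≠ 2 by decide))
      (fun w hw => by simpa [Fin.exists_fin_succ] using hfn w hw)
    rw [(hf 0).2, (hf 1).2, (hf 2).2] at hpar
    simp at hpar
    refine lt_of_le_of_ne hab ?_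
    rintro rfl
    grind
  refine ⟨hlt, exists_involutions ?_ (fun v => ?_) hg hvt⟩
  · intro i j hij
    fin_cases i <;> fin_cases j <;> simp at hij ⊢ <;> omega
  · obtain ⟨f, hf, hfn, -⟩ := h v
    exact ⟨f, hf, hfn⟩

/-- The product of the involutions along a word; its first letter is applied first. -/
def HexWord.eval (P : Fin 3 → Perm V) (w : HexWord) : Perm V :=
  P (w 5) * P (w 4) * P (w 3) * P (w 2) * P (w 1) * P (w 0)

theorem HexWord.eval_rotate (P : Fin 3 → Perm V) (w : HexWord) :
    w.eval P = 1 ↔ HexWord.eval P (fun i => w (i + 1)) = 1 := by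
  change _ ↔ P (w 0) * P (w 5) * P (w 4) * P (w 3) * P (w 2) * P (w 1) = 1
  rw [HexWord.eval, mul_eq_one_comm]
  simp only [mul_assoc]

namespace SimpleGraph.IsInvolutiveColouring

variable {P : Fin 3 → Perm V}

theorem inv_eq (hP : G.IsInvolutiveColouring P) (i : Fin 3) : (P i)⁻¹ = P i :=
  inv_eq_of_mul_eq_one_left (hP.mul_self i)

theorem apply_apply (hP : G.IsInvolutiveColouring P) (i : Fin 3) (v : V) : P i (P i v) = v :=
  Perm.ext_iff.1 (hP.mul_self i) v

theorem adj (hP : G.IsInvolutiveColouring P) (i : Fin 3) (v : V) : G.Adj v (P i v) :=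
  (hP.adj_iff _ _).2 ⟨i, rfl⟩

theorem apply_ne (hP : G.IsInvolutiveColouring P) {i j : Fin 3} (h : i ≠ j) (v : V) :
    v ≠ P i (P j v) := fun hv =>
  h (hP.inj _ _ (P j v) (by rw [hP.apply_apply, ← hv]))

theorem eval_reverse (hP : G.IsInvolutiveColouring P) (w : HexWord) :
    w.eval P = 1 ↔ HexWord.eval P (fun i => w (-i)) = 1 := by
  rw [HexWord.eval_rotate, ← inv_eq_one]
  change (P (w 0) * P (w 5) * P (w 4) * P (w 3) * P (w 2) * P (w 1))⁻¹ = 1 ↔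
    P (w 1) * P (w 2) * P (w 3) * P (w 4) * P (w 5) * P (w 0) = 1
  simp only [mul_inv_rev, hP.inv_eq, mul_assoc]

theorem mul_ne_mul (hP : G.IsInvolutiveColouring P) (hg : G.girth = 6) {i j k l : Fin 3}
    (hij : i ≠ j) (hjl : j ≠ l) (v : V) : P i * P j ≠ P k * P l := by
  intro h
  have hv := Perm.ext_iff.1 h v
  refine no_square hg (hP.adj j v) (hP.adj i _) (z := P i (P j v)) (w := P l v) ?_
    (hP.adj l v).symm (hP.apply_ne hij v) (fun h => hjl (hP.inj _ _ _ h))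
  rw [← Perm.mul_apply, hv, Perm.mul_apply]
  exact (hP.adj k _).symm

theorem eq_of_eval (hP : G.IsInvolutiveColouring P) (hg : G.girth = 6) [Nonempty V] {w w' : HexWord}
    (hw : w.Proper) (h : w.eval P = 1) (h' : w'.eval P = 1) (hpre : ∀ l < 4, w l = w' l) :
    w = w' := by
  obtain ⟨v⟩ := ‹Nonempty V›
  have h0 := hpre 0 (by decide)
  have h1 := hpre 1 (by decide)
  have h2 := hpre 2 (by decide)
  have h3 := hpre 3 (by decide)
  rw [← h', HexWord.eval, HexWord.eval, h0, h1, h2, h3] at h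
  simp only [mul_left_inj] at h
  have h4 : w 4 = w' 4 := by
    by_contra hne
    exact hP.mul_ne_mul hg (hw 4).symm hne v h
  have h5 : w 5 = w' 5 := by
    rw [h4, mul_left_inj] at h
    exact hP.inj _ _ v (by rw [h])
  funext i
  fin_cases i <;> assumption

theorem eval_glue (hP : G.IsInvolutiveColouring P) {w w' : HexWord} (h : w.eval P = 1)
    (h' : w'.eval P = 1) (hpre : ∀ l < 3, w l = w' l) :
    HexWord.eval P ![w 3, w 4, w 5, w' 5, w' 4, w' 3] = 1 := by
  have h0 := hpre 0 (by decide)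
  have h1 := hpre 1 (by decide)
  have h2 := hpre 2 (by decide)
  rw [← h', HexWord.eval, HexWord.eval, h0, h1, h2] at h
  simp only [mul_left_inj] at h
  calc HexWord.eval P ![w 3, w 4, w 5, w' 5, w' 4, w' 3]
      = (P (w' 5) * P (w' 4) * P (w' 3))⁻¹ * (P (w 5) * P (w 4) * P (w 3)) := by
        simp [HexWord.eval, hP.inv_eq, mul_assoc]
    _ = 1 := by rw [h, inv_mul_cancel]

open Classical in
theorem sixCycleCount_eq_card (hP : G.IsInvolutiveColouring P) (hg : G.girth = 6) (v : V)
    (c : Fin 3) :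
    sixCycleCount G s(v, P c v) =
      (Finset.univ.filter fun w : HexWord => w.Proper ∧ w 0 = c ∧ w.eval P = 1).card := by
  rw [sixCycleCount_eq hg, ← Set.ncard_coe_finset]
  symm
  refine Set.ncard_congr (fun w _ => (P (w 1) (P c v), P (w 2) (P (w 1) (P c v)),
    P (w 3) (P (w 2) (P (w 1) (P c v))), P (w 4) (P (w 3) (P (w 2) (P (w 1) (P c v)))))) ?_ ?_ ?_
  · intro w hw
    simp only [Finset.coe_filter, Finset.mem_univ, true_and, Set.mem_ofPred_eq] at hw
    obtain ⟨hp, rfl, he⟩ := hw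
    have h5 : P (w 5) (P (w 4) (P (w 3) (P (w 2) (P (w 1) (P (w 0) v))))) = v :=
      Perm.ext_iff.1 he v
    have hne : ∀ i x, x ≠ P (w (i + 1)) (P (w i) x) := fun i x => hP.apply_ne (hp i).symm x
    refine ⟨hP.adj _ _, hP.adj _ _, hP.adj _ _, hP.adj _ _, hP.adj _ _, ?_, hne 0 _, hne 1 _,
      hne 2 _, hne 3 _, ?_, ?_⟩
    · have := hP.adj (w 5) (P (w 4) (P (w 3) (P (w 2) (P (w 1) (P (w 0) v)))))
      rwa [h5] at this
    · have : _ ≠ P (w 5) (P (w 4) _) := hne 4 (P (w 3) (P (w 2) (P (w 1) (P (w 0) v))))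
      rwa [h5] at this
    · have : _ ≠ P (w 0) (P (w 5) _) := hne 5 (P (w 4) (P (w 3) (P (w 2) (P (w 1) (P (w 0) v)))))
      rwa [h5] at this
  · intro w w' hw hw' h
    simp only [Finset.coe_filter, Finset.mem_univ, true_and, Set.mem_ofPred_eq] at hw hw'
    obtain ⟨-, hc, he⟩ := hw
    obtain ⟨-, hc', he'⟩ := hw'
    simp only [Prod.mk.injEq] at h
    obtain ⟨h1, h2, h3, h4⟩ := h
    replace h1 := hP.inj _ _ _ h1
    rw [h1] at h2
    replace h2 := hP.inj _ _ _ h2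
    rw [h1, h2] at h3
    replace h3 := hP.inj _ _ _ h3
    rw [h1, h2, h3] at h4
    replace h4 := hP.inj _ _ _ h4
    have h5 : w 5 = w' 5 := by
      rw [HexWord.eval, hc, h1, h2, h3, h4, ← he', HexWord.eval, hc'] at he
      simp only [mul_left_inj] at he
      exact hP.inj _ _ v (by rw [he])
    funext i
    fin_cases i
    exacts [hc.trans hc'.symm, h1, h2, h3, h4, h5]
  · rintro ⟨x₂, x₃, x₄, x₅⟩ ⟨a0, a1, a2, a3, a4, a5, n0, n1, n2, n3, n4, n5⟩
    dsimp only at *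
    obtain ⟨i₁, rfl⟩ := (hP.adj_iff _ _).1 a1
    obtain ⟨i₂, rfl⟩ := (hP.adj_iff _ _).1 a2
    obtain ⟨i₃, rfl⟩ := (hP.adj_iff _ _).1 a3
    obtain ⟨i₄, rfl⟩ := (hP.adj_iff _ _).1 a4
    obtain ⟨i₅, h5⟩ := (hP.adj_iff _ _).1 a5
    have hback : ∀ i j x, x ≠ P j (P i x) → i ≠ j := by
      rintro i _ x h rfl
      exact h (hP.apply_apply i x).symm
    refine ⟨![c, i₁, i₂, i₃, i₄, i₅], ?_, rfl⟩
    simp only [Finset.coe_filter, Finset.mem_univ, true_and, Set.mem_ofPred_eq]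
    refine ⟨?_, rfl, hP.free _ ?_ v h5.symm⟩
    · have n5' : i₅ ≠ c := by
        intro h
        have h5' := congrArg (P c) h5
        rw [h, hP.apply_apply] at h5'
        exact n5 h5'.symm
      have hp : c ≠ i₁ ∧ i₁ ≠ i₂ ∧ i₂ ≠ i₃ ∧ i₃ ≠ i₄ ∧ i₄ ≠ i₅ ∧ i₅ ≠ c :=
        ⟨hback _ _ _ n0, hback _ _ _ n1, hback _ _ _ n2, hback _ _ _ n3,
          hback _ _ _ (n4.trans_eq h5), n5'⟩
      intro i
      fin_cases i
      exacts [hp.1, hp.2.1, hp.2.2.1, hp.2.2.2.1, hp.2.2.2.2.1, hp.2.2.2.2.2]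
    · have hmem : ∀ i, P i ∈ Subgroup.closure (Set.range P) := fun i =>
        Subgroup.subset_closure ⟨i, rfl⟩
      simp only [HexWord.eval]
      exact mul_mem (mul_mem (mul_mem (mul_mem (mul_mem (hmem _) (hmem _)) (hmem _)) (hmem _))
        (hmem _)) (hmem _)
end SimpleGraph.IsInvolutiveColouring
end

section
variable {G : Type*} [Group G] {n : ℕ} {ρ y : G}

/-- Powers of an element whose `n`-th power is trivial, with exponents modulo `n`. -/
def zmodPow (h : ρ ^ n = 1) : ZMod n →+ Additive G :=
  ZMod.lift n ⟨zmultiplesHom _ (Additive.ofMul ρ), by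
    simpa [← ofMul_pow] using h⟩

theorem zmodPow_intCast (h : ρ ^ n = 1) (k : ℤ) : (zmodPow h k).toMul = ρ ^ k := by
  simp [zmodPow]

theorem toMul_zmodPow_add (h : ρ ^ n = 1) (i j : ZMod n) :
    (zmodPow h (i + j)).toMul = (zmodPow h i).toMul * (zmodPow h j).toMul := by
  rw [map_add, toMul_add]

theorem toMul_zmodPow_sub (h : ρ ^ n = 1) (i j : ZMod n) :
    (zmodPow h (j - i)).toMul = (zmodPow h i).toMul⁻¹ * (zmodPow h j).toMul := by
  rw [sub_eq_neg_add, map_add, toMul_add, map_neg, toMul_neg]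

theorem conj_zmodPow (h : ρ ^ n = 1) (hy : y * y = 1) (hyρ : y * ρ * y = ρ⁻¹) (i : ZMod n) :
    (zmodPow h i).toMul * y = y * (zmodPow h i).toMul⁻¹ := by
  obtain ⟨k, rfl⟩ := ZMod.intCast_surjective i
  have hinv : y⁻¹ = y := inv_eq_of_mul_eq_one_left hy
  have := conj_zpow (a := y) (b := ρ) (i := k)
  rw [hinv, hyρ] at this
  rw [zmodPow_intCast, ← inv_zpow, this, ← mul_assoc, ← mul_assoc, hy, one_mul]

/-- The homomorphism from a dihedral group determined by images of a rotation and a reflection. -/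
def dihedralLift (h : ρ ^ n = 1) (hy : y * y = 1) (hyρ : y * ρ * y = ρ⁻¹) :
    DihedralGroup n →* G where
  toFun
    | .r i => (zmodPow h i).toMul
    | .sr i => y * (zmodPow h i).toMul
  map_one' := by
    change (zmodPow h 0).toMul = 1
    simp
  map_mul' := by
    rintro (i | i) (j | j)
    · exact toMul_zmodPow_add h i j
    · change y * (zmodPow h (j - i)).toMul = _
      simp only [toMul_zmodPow_sub, ← mul_assoc, conj_zmodPow h hy hyρ]
    · change y * (zmodPow h (i + j)).toMul = _
      simp only [toMul_zmodPow_add, mul_assoc]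
    · change (zmodPow h (j - i)).toMul = y * _ * (y * _)
      rw [toMul_zmodPow_sub, mul_assoc y, ← mul_assoc _ y, conj_zmodPow h hy hyρ, ← mul_assoc,
        ← mul_assoc, hy, one_mul]

theorem dihedralLift_injective (h : ρ ^ n = 1) (hy : y * y = 1) (hyρ : y * ρ * y = ρ⁻¹)
    (hn : ∀ k : ℕ, ρ ^ k = 1 → n ∣ k) (hρ : ρ * ρ ≠ 1) :
    Function.Injective (dihedralLift h hy hyρ) := by
  rw [injective_iff_map_eq_one]
  have hcomm : ∀ i, Commute (zmodPow h i).toMul ρ := by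
    intro i
    obtain ⟨k, rfl⟩ := ZMod.intCast_surjective i
    rw [zmodPow_intCast]
    exact (Commute.refl ρ).zpow_left k
  rintro (i | i) hi
  · change (zmodPow h i).toMul = 1 at hi
    obtain ⟨k, rfl⟩ := ZMod.intCast_surjective i
    rw [zmodPow_intCast, ← orderOf_dvd_iff_zpow_eq_one] at hi
    have := (Int.natCast_dvd_natCast.2 (hn _ (pow_orderOf_eq_one ρ))).trans hi
    rw [(ZMod.intCast_zmod_eq_zero_iff_dvd k n).2 this]
    rfl
  · exfalso
    change y * (zmodPow h i).toMul = 1 at hi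
    have hyi : y = (zmodPow h i).toMul⁻¹ := eq_inv_of_mul_eq_one_left hi
    have hc : Commute y ρ := hyi ▸ (hcomm i).inv_left
    rw [hc.eq, mul_assoc, hy, mul_one] at hyρ
    exact hρ (eq_inv_iff_mul_eq_one.1 hyρ)

end

section
variable {V : Type*} {G : SimpleGraph V} {P : Fin 3 → Perm V}

namespace SimpleGraph.IsInvolutiveColouring

theorem mul_sq_ne_one (hP : G.IsInvolutiveColouring P) [Nonempty V] (hg : G.girth = 6)
    {i j : Fin 3} (hij : i ≠ j) : P i * P j * (P i * P j) ≠ 1 := by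
  obtain ⟨v⟩ := ‹Nonempty V›
  intro h
  refine hP.mul_ne_mul hg hij hij.symm v (k := j) (l := i) ?_
  rw [eq_inv_of_mul_eq_one_left h, mul_inv_rev, hP.inv_eq, hP.inv_eq]

theorem ten_le_orderOf (hP : G.IsInvolutiveColouring P) [Finite V] [Nonempty V]
    (hg : G.girth = 6) (hX : P 0 = P 2 * P 1 * P 2 * P 1 * P 2)
    (hrel : ∀ i, (HexWord.rep i).eval P = 1 ↔ i = 5 ∨ i = 11) :
    10 ≤ orderOf (P 2 * P 1) := by
  have hpow := pow_orderOf_eq_one (P 2 * P 1)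
  have hpos := orderOf_pos (P 2 * P 1)
  generalize orderOf (P 2 * P 1) = n at *
  have hZ := hP.mul_self 2
  have hY := hP.mul_self 1
  have hZ' : ∀ g, P 2 * (P 2 * g) = g := fun g => by rw [← mul_assoc, hZ, one_mul]
  have hXY := hP.mul_sq_ne_one hg (show (0 : Fin 3) ≠ 1 by decide)
  have hXZ := hP.mul_sq_ne_one hg (show (0 : Fin 3) ≠ 2 by decide)
  have hZY := hP.mul_sq_ne_one hg (show (2 : Fin 3) ≠ 1 by decide)
  have hword : ∀ i k, (HexWord.rep i).eval P = P 1 * (P 2 * P 1) ^ k * P 1 →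
      (P 2 * P 1) ^ k = 1 → i = 5 ∨ i = 11 := by
    intro i k hk h
    rw [← hrel, hk, h, mul_one, hY]
  by_contra! hlt
  interval_cases n
  · obtain ⟨v⟩ := ‹Nonempty V›
    rw [pow_one, mul_eq_one_iff_eq_inv, hP.inv_eq] at hpow
    exact absurd (hP.inj 2 1 v (by rw [hpow])) (by decide)
  · exact hZY (by rwa [← sq])
  · have := (hrel 12).1 (by
      rw [← hpow]
      simp [HexWord.rep, HexWord.eval, pow_succ, mul_assoc])
    revert this
    decide
  · refine hXZ (hpow ▸ ?_)
    simp only [hX, pow_succ, pow_zero, one_mul, mul_assoc, hZ, mul_one]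
  · refine absurd (hword 8 5 ?_ hpow) (by decide)
    simp [HexWord.rep, HexWord.eval, hX, pow_succ, mul_assoc, hY]
  · refine hXY (hpow ▸ ?_)
    simp only [hX, pow_succ, pow_zero, one_mul, mul_assoc]
  · refine absurd (hword 2 7 ?_ hpow) (by decide)
    simp [HexWord.rep, HexWord.eval, hX, pow_succ, mul_assoc, hY]
  · refine absurd (hword 1 8 ?_ hpow) (by decide)
    simp [HexWord.rep, HexWord.eval, hX, pow_succ, mul_assoc, hY, hZ']
  · refine absurd (hword 0 9 ?_ hpow) (by decide)
    simp [HexWord.rep, HexWord.eval, hX, pow_succ, mul_assoc, hY]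

theorem exists_iso_psiGraph (hP : G.IsInvolutiveColouring P) (hconn : G.Connected)
    (hX : P 0 = P 2 * P 1 * P 2 * P 1 * P 2) (hsq : P 2 * P 1 * (P 2 * P 1) ≠ 1) :
    Nonempty (G ≃g psiGraph (orderOf (P 2 * P 1))) := by
  obtain ⟨v⟩ := hconn.nonempty
  have hY := hP.mul_self 1
  set n := orderOf (P 2 * P 1)
  let F : DihedralGroup n →* Perm V := dihedralLift (pow_orderOf_eq_one (P 2 * P 1)) hY
    (by rw [mul_inv_rev, hP.inv_eq, hP.inv_eq, mul_assoc, mul_assoc, hY, mul_one])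
  have hF : Function.Injective F :=
    dihedralLift_injective _ _ _ (fun k hk => orderOf_dvd_of_pow_eq_one hk) hsq
  have hr : F (.r 1) = P 2 * P 1 := by
    have := zmodPow_intCast (pow_orderOf_eq_one (P 2 * P 1)) 1
    rwa [Int.cast_one, zpow_one] at this
  have hs : F (.sr 0) = P 1 := by
    change P 1 * (zmodPow _ 0).toMul = _
    simp
  let t : Fin 3 → DihedralGroup n := ![dihTau 3, dihTau 0, dihTau 1]
  have ht : ∀ i, F (t i) = P i := by
    have htau : ∀ k, F (dihTau k) = (P 2 * P 1) ^ k * P 1 := fun k => by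
      rw [dihTau, map_mul, map_pow, hr, hs]
    intro i
    fin_cases i <;> simp [t, htau, hX, pow_succ, mul_assoc, hY]
  have htt : ∀ i, (t i)⁻¹ = t i := fun i => hF (by rw [map_inv, ht, hP.inv_eq])
  have hmem : ∀ g, F g ∈ Subgroup.closure (Set.range P) := by
    have hgen : ∀ i, P i ∈ Subgroup.closure (Set.range P) := fun i =>
      Subgroup.subset_closure ⟨i, rfl⟩
    have hz : ∀ i : ZMod n, (zmodPow (pow_orderOf_eq_one (P 2 * P 1)) i).toMul ∈
        Subgroup.closure (Set.range P) := by
      intro i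
      obtain ⟨k, rfl⟩ := ZMod.intCast_surjective i
      rw [zmodPow_intCast]
      exact zpow_mem (mul_mem (hgen 2) (hgen 1)) k
    rintro (i | i)
    · exact hz i
    · exact mul_mem (hgen 1) (hz i)
  have hfree : ∀ g h, F g v = F h v → g = h := by
    intro g h hgh
    have := hP.free (F (h⁻¹ * g)) (hmem _) v (by simp [hgh])
    rw [← map_one F] at this
    exact (inv_mul_eq_one.1 (hF this)).symm
  have hsurj : ∀ w, ∃ g, F g v = w := by
    intro w
    obtain ⟨p⟩ := hconn.preconnected w v
    clear hfree
    induction p with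
    | nil => exact ⟨1, by simp⟩
    | cons h _ ih =>
      obtain ⟨g, rfl⟩ := ih
      obtain ⟨i, rfl⟩ := (hP.adj_iff _ _).1 h.symm
      exact ⟨t i * g, by simp [ht]⟩
  have hmemS : ∀ x : DihedralGroup n,
      x ∈ ({dihTau 0, dihTau 1, dihTau 3} : Set (DihedralGroup n)) ↔ ∃ i, x = t i := by
    intro x
    simp only [Set.mem_insert_iff, Set.mem_singleton_iff, Fin.exists_fin_succ, t]
    simp
    tauto
  refine ⟨RelIso.symm ⟨Equiv.ofBijective (fun g => F g v) ⟨hfree, hsurj⟩, ?_⟩⟩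
  intro g h
  change G.Adj (F g v) (F h v) ↔ (cayley _).Adj g h
  rw [hP.adj_iff, cayley, SimpleGraph.fromRel_adj, hmemS, hmemS]
  have hswap : (∃ i, g * h⁻¹ = t i) ↔ ∃ i, h * g⁻¹ = t i := by
    refine exists_congr fun i => ?_
    rw [← htt, ← inv_inj, mul_inv_rev, inv_inv, inv_inv, htt]
  rw [hswap, or_self]
  constructor
  · rintro ⟨i, hi⟩
    have hh : h = t i * g := hfree _ _ (by simp [hi, ht])
    refine ⟨?_, i, by simp [hh]⟩
    rintro rfl
    exact (hP.adj i (F g v)).ne hi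
  · rintro ⟨-, i, hi⟩
    exact ⟨i, by rw [mul_inv_eq_iff_eq_mul.1 hi, map_mul, ht, Perm.mul_apply]⟩

end SimpleGraph.IsInvolutiveColouring
end

/-- A finite connected simple cubic vertex-transitive graph of girth 6
with signature `(a, b, 5)` where `b < 5` has `a = 3`, `b = 4`, and is isomorphic
to `Ψ_n` for some `n ≥ 10`. -/
theorem cubic_vt_girth_six_signature_b_lt_c_eq_five {V : Type*} [Fintype V] (Γ : SimpleGraph V)
    (hconn : Γ.Connected)
    (hcubic : ∀ v : V, (Γ.neighborSet v).ncard = 3)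
    (hvt : ∀ u v : V, ∃ φ : Γ ≃g Γ, φ u = v)
    (hgirth : Γ.girth = 6)
    (a b : ℕ) (hab : a ≤ b) (hb : b < 5)
    (hsig : hasSignature Γ a b 5) :
    a = 3 ∧ b = 4 ∧ ∃ n : ℕ, 10 ≤ n ∧ Nonempty (Γ ≃g psiGraph n) := by
  have := hconn.nonempty
  obtain ⟨hlt, P, hP, hcount⟩ := exists_involutions_of_hasSignature hgirth hvt hab hb hsig
  obtain ⟨v⟩ := hconn.nonempty
  obtain ⟨ha, hb', hrel⟩ := HexWord.rel_classification (Rel := fun w => w.eval P = 1)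
    (HexWord.eval_rotate P) hP.eval_reverse
    (fun w w' hw _ h h' hpre => hP.eq_of_eval hgirth hw h h' hpre)
    (fun w w' h h' hpre => hP.eval_glue h h' hpre) hlt hb
    (fun c => by rw [← hP.sixCycleCount_eq_card hgirth v c, hcount])
  have hX : P 0 = P 2 * P 1 * P 2 * P 1 * P 2 := by
    have h := (hrel 11).2 (Or.inr rfl)
    change P 2 * P 1 * P 2 * P 1 * P 2 * P 0 = 1 at h
    rw [eq_inv_of_mul_eq_one_left h, hP.inv_eq]
  exact ⟨ha, hb', _, hP.ten_le_orderOf hgirth hX hrel,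
    hP.exists_iso_psiGraph hconn hX (hP.mul_sq_ne_one hgirth (by decide))⟩
end
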